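/- Fix λ > 0, δ > 0 and s ≥ 0. The covariance of the mixed fractional Poissonian noise satisfies lim_{t→∞} t^{2−α₂} Cov_Z(s,t) = (1−α₂) δ λ² (K(s+δ) − K(s)). -/

import Mathlib

open Real MeasureTheory Filter Topology

/-- Two-parameter Mittag-Leffler function `E_{a,b}(x)`. -/
noncomputable def ML (a b x : ℝ) : ℝ :=
  ∑' k : ℕ, x ^ k / Real.Gamma ((k : ℝ) * a + b)

/-- Second-order (three-parameter, `γ = 2`) Mittag-Leffler function `E²_{a,b}(x)`. -/
noncomputable def ML2 (a b x : ℝ) : ℝ :=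
  ∑' k : ℕ, ((k : ℝ) + 1) * x ^ k / Real.Gamma ((k : ℝ) * a + b)

/-- Renewal function `U(t)` of the inverse mixed stable subordinator. -/
noncomputable def Ufun (a1 a2 C1 C2 t : ℝ) : ℝ :=
  t ^ a1 / C1 * ML (a1 - a2) (a1 + 1) (-C2 * t ^ (a1 - a2) / C1)

/-- Renewal density `u(t)` of the inverse mixed stable subordinator. -/
noncomputable def ufun (a1 a2 C1 C2 t : ℝ) : ℝ :=
  t ^ (a1 - 1) / C1 * ML (a1 - a2) a1 (-C2 * t ^ (a1 - a2) / C1)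

/-- Covariance function of the inverse mixed stable subordinator. -/
noncomputable def CovY (a1 a2 C1 C2 s t : ℝ) : ℝ :=
  (∫ τ in (0:ℝ)..(min s t),
      (Ufun a1 a2 C1 C2 (s - τ) + Ufun a1 a2 C1 C2 (t - τ)) * ufun a1 a2 C1 C2 τ)
    - Ufun a1 a2 C1 C2 s * Ufun a1 a2 C1 C2 t

/-- Variance function of the inverse mixed stable subordinator. -/
noncomputable def VarY (a1 a2 C1 C2 t : ℝ) : ℝ := CovY a1 a2 C1 C2 t t

/-- The integral `I(s,t) = ∫₀^s U(t-τ) u(τ) dτ`. -/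
noncomputable def Ifun (a1 a2 C1 C2 s t : ℝ) : ℝ :=
  ∫ τ in (0:ℝ)..s, Ufun a1 a2 C1 C2 (t - τ) * ufun a1 a2 C1 C2 τ

/-- The constant `K(s)`. -/
noncomputable def Kfun (a1 a2 C1 C2 s : ℝ) : ℝ :=
  s ^ (a1 + 1) / (C1 * C2 * Real.Gamma a2) *
    ∑' k : ℕ, ((k : ℝ) * (a1 - a2) + a1) * (-C2 * s ^ (a1 - a2) / C1) ^ k /
      Real.Gamma ((k : ℝ) * (a1 - a2) + a1 + 2)

/-- Covariance function of the mixed fractional Poisson process. -/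
noncomputable def CovN (a1 a2 C1 C2 lam s t : ℝ) : ℝ :=
  lam * Ufun a1 a2 C1 C2 (min s t) + lam ^ 2 * CovY a1 a2 C1 C2 s t

/-- Variance function of the mixed fractional Poisson process. -/
noncomputable def VarN (a1 a2 C1 C2 lam t : ℝ) : ℝ :=
  lam * Ufun a1 a2 C1 C2 t + lam ^ 2 * VarY a1 a2 C1 C2 t

/-- Correlation function of the inverse mixed stable subordinator. -/
noncomputable def CorrY (a1 a2 C1 C2 s t : ℝ) : ℝ :=
  CovY a1 a2 C1 C2 s t /
    (Real.sqrt (VarY a1 a2 C1 C2 s) * Real.sqrt (VarY a1 a2 C1 C2 t))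

/-- Correlation function of the mixed fractional Poisson process. -/
noncomputable def CorrN (a1 a2 C1 C2 lam s t : ℝ) : ℝ :=
  CovN a1 a2 C1 C2 lam s t /
    (Real.sqrt (VarN a1 a2 C1 C2 lam s) * Real.sqrt (VarN a1 a2 C1 C2 lam t))

/-- Covariance function of the mixed fractional Poissonian noise. -/
noncomputable def CovZ (a1 a2 C1 C2 lam δ s t : ℝ) : ℝ :=
  CovN a1 a2 C1 C2 lam (s + δ) (t + δ) + CovN a1 a2 C1 C2 lam s t
    - CovN a1 a2 C1 C2 lam (s + δ) t - CovN a1 a2 C1 C2 lam s (t + δ)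

/-- Variance function of the mixed fractional Poissonian noise. -/
noncomputable def VarZ (a1 a2 C1 C2 lam δ t : ℝ) : ℝ := CovZ a1 a2 C1 C2 lam δ t t

/-- Correlation function of the mixed fractional Poissonian noise. -/
noncomputable def CorrZ (a1 a2 C1 C2 lam δ s t : ℝ) : ℝ :=
  CovZ a1 a2 C1 C2 lam δ s t /
    (Real.sqrt (VarZ a1 a2 C1 C2 lam δ s) * Real.sqrt (VarZ a1 a2 C1 C2 lam δ t))

/-- Incomplete Beta function `B(a, b; x)`. -/
noncomputable def Binc (a b x : ℝ) : ℝ :=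
  ∫ y in (0:ℝ)..x, y ^ (a - 1) * (1 - y) ^ (b - 1)

lemma inv_Gamma_le {y M : ℝ} (hy : 0 < y) (hM : 0 < M) :
    1 / Gamma y ≤ y * exp M * M ^ (-y) := by
  have hG : M ^ y * exp (-M) ≤ Gamma (y + 1) := by
    rw [Gamma_eq_integral (by linarith), add_sub_cancel_right, ← integral_exp_neg_Ioi M,
      ← integral_const_mul]
    have hintg : IntegrableOn (fun x => exp (-x) * x ^ y) (Set.Ioi 0) := by
      simpa using GammaIntegral_convergent (s := y + 1) (by linarith)
    have hsub : Set.Ioi M ⊆ Set.Ioi (0 : ℝ) := Set.Ioi_subset_Ioi hM.le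
    calc ∫ x in Set.Ioi M, M ^ y * exp (-x) ≤ ∫ x in Set.Ioi M, exp (-x) * x ^ y := by
          refine setIntegral_mono_on ?_ (hintg.mono_set hsub) measurableSet_Ioi ?_
          · exact (integrableOn_exp_neg_Ioi M).const_mul _
          · intro x hx
            rw [mul_comm]
            have : M ≤ x := le_of_lt hx
            gcongr
      _ ≤ _ := by
          refine setIntegral_mono_set hintg ?_ hsub.eventuallyLE
          filter_upwards [ae_restrict_mem measurableSet_Ioi] with x hx
          have : (0 : ℝ) < x := hx
          simp only [Pi.zero_apply]
          positivity
  have hGy := Gamma_pos_of_pos hy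
  rw [Gamma_add_one hy.ne'] at hG
  rw [div_le_iff₀ hGy]
  calc (1 : ℝ) = (exp M * M ^ (-y)) * (M ^ y * exp (-M)) := by
        rw [rpow_neg hM.le, exp_neg]
        field_simp
    _ ≤ (exp M * M ^ (-y)) * (y * Gamma y) := by gcongr
    _ = _ := by ring

lemma summable_pow_div_Gamma {a b : ℝ} (ha : 0 < a) (hb : 0 < b) (x : ℝ) :
    Summable fun k : ℕ => x ^ k / Gamma ((k : ℝ) * a + b) := by
  obtain ⟨M, hM, hM0⟩ : ∃ M : ℝ, |x| + 1 < M ^ a ∧ 0 < M :=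
    (((tendsto_rpow_atTop ha).eventually_gt_atTop (|x| + 1)).and (eventually_gt_atTop 0)).exists
  have hx0 := abs_nonneg x
  have hr0 : 0 ≤ |x| / M ^ a := by positivity
  have hr : |x| / M ^ a < 1 := by
    rw [div_lt_one (by positivity)]
    linarith
  have h1 := (summable_pow_mul_geometric_of_norm_lt_one (R := ℝ) 1
    (r := |x| / M ^ a) (by rwa [norm_of_nonneg hr0])).mul_left (a * exp M * M ^ (-b))
  have h0 := (summable_geometric_of_lt_one hr0 hr).mul_left (b * exp M * M ^ (-b))
  refine Summable.of_norm_bounded (h1.add h0) fun k => ?_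
  have hy : 0 < (k : ℝ) * a + b := by positivity
  have hG := inv_Gamma_le hy hM0
  rw [norm_div, norm_pow, norm_eq_abs, norm_of_nonneg (Gamma_pos_of_pos hy).le,
    div_eq_mul_one_div]
  have hpow : M ^ (-((k : ℝ) * a + b)) = M ^ (-b) / (M ^ a) ^ k := by
    rw [neg_add, rpow_add hM0, rpow_neg hM0.le, mul_comm (k : ℝ) a, rpow_mul hM0.le,
      rpow_natCast]
    field_simp
  calc |x| ^ k * (1 / Gamma ((k : ℝ) * a + b))
      ≤ |x| ^ k * (((k : ℝ) * a + b) * exp M * M ^ (-((k : ℝ) * a + b))) := by gcongr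
    _ = _ := by
      rw [hpow, div_pow]
      ring

lemma continuous_ML {a b : ℝ} (ha : 0 < a) (hb : 0 < b) : Continuous (ML a b) := by
  rw [continuous_iff_continuousAt]
  intro x
  have hx : Set.Icc (-(|x| + 1)) (|x| + 1) ∈ 𝓝 x :=
    Icc_mem_nhds (by linarith [neg_abs_le x]) (by linarith [le_abs_self x])
  refine ContinuousOn.continuousAt (s := Set.Icc (-(|x| + 1)) (|x| + 1)) ?_ hx
  refine continuousOn_tsum (fun k => by fun_prop) (summable_pow_div_Gamma ha hb (|x| + 1)) ?_
  intro k y hy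
  have hy' : |y| ≤ |x| + 1 := abs_le.2 hy
  have hG : 0 < Gamma ((k : ℝ) * a + b) := Gamma_pos_of_pos (by positivity)
  rw [norm_div, norm_pow, norm_eq_abs, norm_of_nonneg hG.le]
  gcongr

lemma integral_rpow_mul_ML {a b q s : ℝ} (ha : 0 < a) (hb : 0 < b) (hq : 0 < q) (hs : 0 ≤ s)
    (κ : ℝ) :
    ∫ τ in (0 : ℝ)..s, τ ^ (q - 1) * ML a b (κ * τ ^ a) =
      s ^ q * ∑' k : ℕ, (κ * s ^ a) ^ k / (((k : ℝ) * a + q) * Gamma ((k : ℝ) * a + b)) := by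
  have key : HasSum
      (fun k : ℕ => ∫ τ in (0 : ℝ)..s, τ ^ (q - 1) * ((κ * τ ^ a) ^ k / Gamma ((k : ℝ) * a + b)))
      (∫ τ in (0 : ℝ)..s, τ ^ (q - 1) * ML a b (κ * τ ^ a)) := by
    refine intervalIntegral.hasSum_integral_of_dominated_convergence
      (fun k τ => τ ^ (q - 1) * ((|κ| * s ^ a) ^ k / Gamma ((k : ℝ) * a + b))) ?_ ?_ ?_ ?_ ?_
    · intro k
      refine Measurable.aestronglyMeasurable ?_
      fun_prop
    · refine fun k => ae_of_all _ fun τ hτ => ?_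
      rw [Set.uIoc_of_le hs] at hτ
      have hτ0 := hτ.1
      have hG : 0 < Gamma ((k : ℝ) * a + b) := Gamma_pos_of_pos (by positivity)
      rw [norm_mul, norm_div, norm_pow, norm_mul, norm_eq_abs κ, norm_of_nonneg hG.le,
        norm_of_nonneg (by positivity : 0 ≤ τ ^ (q - 1)),
        norm_of_nonneg (by positivity : 0 ≤ τ ^ a)]
      have := hτ.2
      gcongr
    · exact ae_of_all _ fun τ _ => (summable_pow_div_Gamma ha hb _).mul_left _
    · simp_rw [tsum_mul_left]
      exact (intervalIntegral.intervalIntegrable_rpow' (by linarith)).mul_const _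
    · exact ae_of_all _ fun τ _ => (summable_pow_div_Gamma ha hb _).hasSum.mul_left _
  rw [← key.tsum_eq, ← tsum_mul_left]
  refine tsum_congr fun k => ?_
  have hG : 0 < Gamma ((k : ℝ) * a + b) := Gamma_pos_of_pos (by positivity)
  have hk : 0 < (k : ℝ) * a + q := by positivity
  have : ∀ τ ∈ Set.uIcc 0 s, τ ^ (q - 1) * ((κ * τ ^ a) ^ k / Gamma ((k : ℝ) * a + b))
      = (κ ^ k / Gamma ((k : ℝ) * a + b)) * τ ^ ((k : ℝ) * a + q - 1) ∨ τ = 0 := by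
    intro τ hτ
    rw [Set.uIcc_of_le hs] at hτ
    rcases hτ.1.eq_or_lt with h | h
    · exact Or.inr h.symm
    · left
      rw [mul_pow, add_sub_assoc, rpow_add h, mul_comm (k : ℝ) a, rpow_mul h.le, rpow_natCast]
      ring
  have hae : ∀ᵐ τ : ℝ, τ ∈ Set.uIoc 0 s →
      τ ^ (q - 1) * ((κ * τ ^ a) ^ k / Gamma ((k : ℝ) * a + b))
      = (κ ^ k / Gamma ((k : ℝ) * a + b)) * τ ^ ((k : ℝ) * a + q - 1) := by
    refine ae_of_all _ fun τ hτ => (this τ (Set.uIoc_subset_uIcc hτ)).resolve_right ?_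
    rw [Set.uIoc_of_le hs] at hτ
    exact hτ.1.ne'
  rw [intervalIntegral.integral_congr_ae hae, intervalIntegral.integral_const_mul,
    integral_rpow (Or.inl (by linarith)), sub_add_cancel, zero_rpow hk.ne', sub_zero]
  rcases hs.eq_or_lt with h | h
  · subst h
    rw [zero_rpow hk.ne', zero_rpow hq.ne']
    simp
  · rw [rpow_add h, mul_pow, mul_comm (k : ℝ) a, rpow_mul h.le, rpow_natCast]
    field_simp

section Renewal

variable {a1 a2 C1 C2 : ℝ}

lemma continuous_Ufun (ha2 : 0 < a2) (ha12 : a2 < a1) : Continuous (Ufun a1 a2 C1 C2) := by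
  have h1 := continuous_ML (a := a1 - a2) (b := a1 + 1) (by linarith) (by linarith)
  have h2 : Continuous fun t : ℝ => t ^ a1 := continuous_id.rpow_const fun _ => Or.inr (by linarith)
  have h3 : Continuous fun t : ℝ => t ^ (a1 - a2) :=
    continuous_id.rpow_const fun _ => Or.inr (by linarith)
  unfold Ufun
  fun_prop

lemma intervalIntegrable_ufun (ha2 : 0 < a2) (ha12 : a2 < a1) (x y : ℝ) :
    IntervalIntegrable (ufun a1 a2 C1 C2) volume x y := by
  have h1 := continuous_ML (a := a1 - a2) (b := a1) (by linarith) (by linarith)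
  have h3 : Continuous fun t : ℝ => t ^ (a1 - a2) :=
    continuous_id.rpow_const fun _ => Or.inr (by linarith)
  unfold ufun
  refine ((intervalIntegral.intervalIntegrable_rpow' (by linarith)).div_const _).mul_continuousOn ?_
  fun_prop

lemma integral_ufun (ha2 : 0 < a2) (ha12 : a2 < a1) {s : ℝ} (hs : 0 ≤ s) :
    ∫ τ in (0 : ℝ)..s, ufun a1 a2 C1 C2 τ = Ufun a1 a2 C1 C2 s := by
  have h := integral_rpow_mul_ML (a := a1 - a2) (b := a1) (q := a1) (by linarith) (by linarith)
    (by linarith) hs (-C2 / C1)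
  have e : ∀ τ, ufun a1 a2 C1 C2 τ
      = C1⁻¹ * (τ ^ (a1 - 1) * ML (a1 - a2) a1 (-C2 / C1 * τ ^ (a1 - a2))) := by
    intro τ
    unfold ufun
    ring_nf
  simp_rw [e]
  rw [intervalIntegral.integral_const_mul, h, Ufun, ML]
  have : ∀ k : ℕ, (-C2 / C1 * s ^ (a1 - a2)) ^ k /
      (((k : ℝ) * (a1 - a2) + a1) * Gamma ((k : ℝ) * (a1 - a2) + a1))
      = (-C2 * s ^ (a1 - a2) / C1) ^ k / Gamma ((k : ℝ) * (a1 - a2) + (a1 + 1)) := by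
    intro k
    have hk : 0 < (k : ℝ) * (a1 - a2) + a1 := by
      have : 0 ≤ (k : ℝ) * (a1 - a2) := mul_nonneg (by positivity) (by linarith)
      linarith
    rw [← add_assoc, Gamma_add_one hk.ne']
    ring_nf
  simp_rw [this]
  ring

lemma integral_mul_ufun (ha2 : 0 < a2) (ha12 : a2 < a1) (hC2 : C2 ≠ 0) {s : ℝ} (hs : 0 ≤ s) :
    ∫ τ in (0 : ℝ)..s, τ * ufun a1 a2 C1 C2 τ = C2 * Gamma a2 * Kfun a1 a2 C1 C2 s := by
  have h := integral_rpow_mul_ML (a := a1 - a2) (b := a1) (q := a1 + 1) (by linarith)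
    (by linarith) (by linarith) hs (-C2 / C1)
  have e : ∀ τ ∈ Set.uIcc 0 s, τ * ufun a1 a2 C1 C2 τ
      = C1⁻¹ * (τ ^ (a1 + 1 - 1) * ML (a1 - a2) a1 (-C2 / C1 * τ ^ (a1 - a2))) := by
    intro τ hτ
    rw [Set.uIcc_of_le hs] at hτ
    have : τ * τ ^ (a1 - 1) = τ ^ (a1 + 1 - 1) := by
      rw [add_sub_cancel_right, mul_comm, ← rpow_add_one' hτ.1 (by linarith), sub_add_cancel]
    rw [← this]
    unfold ufun
    ring_nf
  rw [intervalIntegral.integral_congr e]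
  rw [intervalIntegral.integral_const_mul, h, Kfun]
  have : ∀ k : ℕ, (-C2 / C1 * s ^ (a1 - a2)) ^ k /
      (((k : ℝ) * (a1 - a2) + (a1 + 1)) * Gamma ((k : ℝ) * (a1 - a2) + a1))
      = ((k : ℝ) * (a1 - a2) + a1) * (-C2 * s ^ (a1 - a2) / C1) ^ k /
        Gamma ((k : ℝ) * (a1 - a2) + a1 + 2) := by
    intro k
    have hk : 0 < (k : ℝ) * (a1 - a2) + a1 := by
      have : 0 ≤ (k : ℝ) * (a1 - a2) := mul_nonneg (by positivity) (by linarith)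
      linarith
    have hG := Gamma_pos_of_pos hk
    rw [show (k : ℝ) * (a1 - a2) + a1 + 2 = (k : ℝ) * (a1 - a2) + a1 + 1 + 1 by ring,
      Gamma_add_one (by linarith), Gamma_add_one hk.ne', ← add_assoc,
      show -C2 / C1 * s ^ (a1 - a2) = -C2 * s ^ (a1 - a2) / C1 by ring]
    generalize (k : ℝ) * (a1 - a2) + a1 = y at *
    field_simp
  simp_rw [this]
  have := Gamma_pos_of_pos ha2
  generalize ∑' k : ℕ, ((k : ℝ) * (a1 - a2) + a1) * (-C2 * s ^ (a1 - a2) / C1) ^ k /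
      Gamma ((k : ℝ) * (a1 - a2) + a1 + 2) = S
  field_simp


lemma integrable_tsum_of_summable_integral_norm {α : Type*} [MeasurableSpace α] {μ : Measure α}
    {F : ℕ → α → ℝ} (hF : ∀ i, Integrable (F i) μ) (hs : Summable fun i => ∫ x, ‖F i x‖ ∂μ)
    (hm : AEStronglyMeasurable (fun x => ∑' i, F i x) μ) :
    Integrable (fun x => ∑' i, F i x) μ := by
  refine ⟨hm, ?_⟩
  calc ∫⁻ x, ‖∑' i, F i x‖ₑ ∂μ ≤ ∫⁻ x, ∑' i, ‖F i x‖ₑ ∂μ :=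
        lintegral_mono fun x => enorm_tsum_le_tsum_enorm
    _ = ∑' i, ∫⁻ x, ‖F i x‖ₑ ∂μ := lintegral_tsum fun i => (hF i).1.enorm
    _ = ∑' i, ENNReal.ofReal (∫ x, ‖F i x‖ ∂μ) := by
        simp_rw [ofReal_integral_norm_eq_lintegral_enorm (hF _)]
    _ = ENNReal.ofReal (∑' i, ∫ x, ‖F i x‖ ∂μ) :=
        (ENNReal.ofReal_tsum_of_nonneg (fun i => by positivity) hs).symm
    _ < ⊤ := ENNReal.ofReal_lt_top

lemma Ufun_laplace_real (ha2 : 0 < a2) (ha12 : a2 < a1) (hC1 : 0 < C1) (hC2 : 0 < C2) {x : ℝ}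
    (hx : 0 < x) (hxa : C2 / C1 < x ^ (a1 - a2)) :
    IntegrableOn (fun t => Ufun a1 a2 C1 C2 t * exp (-(x * t))) (Set.Ioi 0) ∧
    ∫ t in Set.Ioi 0, Ufun a1 a2 C1 C2 t * exp (-(x * t))
      = 1 / (x * (C1 * x ^ a1 + C2 * x ^ a2)) := by
  have ha1 : 0 < a1 := ha2.trans ha12
  have ha : 0 < a1 - a2 := by linarith
  set F : ℕ → ℝ → ℝ := fun k t => t ^ a1 / C1 * ((-C2 * t ^ (a1 - a2) / C1) ^ k /
    Gamma ((k : ℝ) * (a1 - a2) + (a1 + 1))) * exp (-(x * t)) with hFdef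
  have hUF : ∀ t, Ufun a1 a2 C1 C2 t * exp (-(x * t)) = ∑' k, F k t := by
    intro t
    simp_rw [hFdef, Ufun, ML, tsum_mul_right, tsum_mul_left]
  have hb : ∀ k : ℕ, 0 < (k : ℝ) * (a1 - a2) + (a1 + 1) := fun k => by positivity
  have hFform : ∀ k, ∀ t ∈ Set.Ioi (0 : ℝ), F k t
      = ((-(C2 / C1)) ^ k / (C1 * Gamma ((k : ℝ) * (a1 - a2) + (a1 + 1)))) *
        (t ^ ((k : ℝ) * (a1 - a2) + (a1 + 1) - 1) * exp (-(x * t))) := by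
    intro k t ht
    have ht' : 0 < t := ht
    have hG := Gamma_pos_of_pos (hb k)
    rw [hFdef]
    simp only
    rw [show (k : ℝ) * (a1 - a2) + (a1 + 1) - 1 = (a1 - a2) * k + a1 by ring, rpow_add ht',
      rpow_mul ht'.le, rpow_natCast,
      show -C2 * t ^ (a1 - a2) / C1 = (-(C2 / C1)) * t ^ (a1 - a2) by ring, mul_pow]
    field_simp
  have hnorm : ∀ k, ∀ t ∈ Set.Ioi (0 : ℝ), ‖F k t‖
      = ((C2 / C1) ^ k / (C1 * Gamma ((k : ℝ) * (a1 - a2) + (a1 + 1)))) *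
        (t ^ ((k : ℝ) * (a1 - a2) + (a1 + 1) - 1) * exp (-(x * t))) := by
    intro k t ht
    have ht' : 0 < t := ht
    have hG := Gamma_pos_of_pos (hb k)
    rw [hFform k t ht, norm_mul, norm_of_nonneg (by positivity :
      0 ≤ t ^ ((k : ℝ) * (a1 - a2) + (a1 + 1) - 1) * exp (-(x * t))), norm_div, norm_pow, norm_neg,
      norm_of_nonneg (by positivity : 0 ≤ C2 / C1),
      norm_of_nonneg (by positivity : 0 ≤ C1 * Gamma ((k : ℝ) * (a1 - a2) + (a1 + 1)))]
  have hval : ∀ r : ℝ, ∀ k : ℕ, ∫ t in Set.Ioi (0 : ℝ),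
      (r ^ k / (C1 * Gamma ((k : ℝ) * (a1 - a2) + (a1 + 1)))) *
        (t ^ ((k : ℝ) * (a1 - a2) + (a1 + 1) - 1) * exp (-(x * t)))
      = 1 / (C1 * x ^ (a1 + 1)) * (r / x ^ (a1 - a2)) ^ k := by
    intro r k
    have hG := Gamma_pos_of_pos (hb k)
    rw [integral_const_mul, integral_rpow_mul_exp_neg_mul_Ioi (hb k) hx, one_div x,
      inv_rpow hx.le, mul_comm (k : ℝ), rpow_add hx, rpow_mul hx.le, rpow_natCast, div_pow]
    rw [mul_comm (k : ℝ)] at hG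
    field_simp
  have hintg : ∀ k, IntegrableOn (F k) (Set.Ioi 0) := by
    intro k
    refine IntegrableOn.congr_fun ?_ (fun t ht => (hFform k t ht).symm) measurableSet_Ioi
    refine Integrable.const_mul ?_ _
    refine Integrable.of_integral_ne_zero ?_
    rw [integral_rpow_mul_exp_neg_mul_Ioi (hb k) hx]
    have hG := Gamma_pos_of_pos (hb k)
    positivity
  have hr : C2 / C1 / x ^ (a1 - a2) < 1 := by
    rwa [div_lt_one (by positivity)]
  have hsum : Summable fun k => ∫ t in Set.Ioi (0 : ℝ), ‖F k t‖ := by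
    simp_rw [fun k => (setIntegral_congr_fun measurableSet_Ioi (hnorm k)).trans (hval _ k)]
    exact (summable_geometric_of_lt_one (by positivity) hr).mul_left _
  have hcont : Continuous fun t => Ufun a1 a2 C1 C2 t * exp (-(x * t)) := by
    have := continuous_Ufun (C1 := C1) (C2 := C2) ha2 ha12
    fun_prop
  constructor
  · have hm := hcont.aestronglyMeasurable (μ := volume.restrict (Set.Ioi 0))
    simp_rw [hUF] at hm ⊢
    exact integrable_tsum_of_summable_integral_norm hintg hsum hm
  · simp_rw [hUF]
    rw [← (hasSum_integral_of_summable_integral_norm hintg hsum).tsum_eq]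
    simp_rw [fun k => (setIntegral_congr_fun measurableSet_Ioi (hFform k)).trans (hval _ k),
      tsum_mul_left]
    rw [tsum_geometric_of_norm_lt_one]
    · have h1 : x ^ a1 = x ^ (a1 - a2) * x ^ a2 := by rw [← rpow_add hx]; ring_nf
      have h2 : 0 < x ^ (a1 - a2) := by positivity
      have h3 : 0 < x ^ a2 := by positivity
      rw [rpow_add_one hx.ne', h1]
      generalize x ^ (a1 - a2) = p at *
      generalize x ^ a2 = q at *
      have h4 : 1 - -(C2 / C1) / p ≠ 0 := by
        have : 0 < C2 / C1 / p := by positivity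
        rw [neg_div]
        linarith
      have h5 : (1 - -(C2 / C1) / p) = (C1 * p + C2) / (C1 * p) := by
        field_simp
        ring
      rw [h5]
      field_simp
    · rw [neg_div, norm_neg, norm_of_nonneg (by positivity)]
      exact hr

lemma differentiableOn_laplace {f : ℝ → ℝ} {x₀ : ℝ}
    (hf : IntegrableOn (fun t => f t * exp (-(x₀ * t))) (Set.Ioi 0))
    (hm : AEStronglyMeasurable f (volume.restrict (Set.Ioi 0))) :
    DifferentiableOn ℂ (fun z : ℂ => ∫ t in Set.Ioi (0 : ℝ), (f t : ℂ) * Complex.exp (-(z * t)))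
      {z | x₀ < z.re} := by
  intro z₀ hz₀
  have hz₀' : x₀ < z₀.re := hz₀
  set ε := (z₀.re - x₀) / 2 with hε
  have hε0 : 0 < ε := by rw [hε]; linarith
  have hm' : AEStronglyMeasurable (fun t => (f t : ℂ)) (volume.restrict (Set.Ioi 0)) :=
    Complex.continuous_ofReal.comp_aestronglyMeasurable hm
  have hmeas : ∀ z : ℂ, AEStronglyMeasurable (fun t : ℝ => (f t : ℂ) * Complex.exp (-(z * t)))
      (volume.restrict (Set.Ioi 0)) := fun z =>
    hm'.mul (by fun_prop : Continuous fun t : ℝ => Complex.exp (-(z * t))).aestronglyMeasurable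
  have hnorm : ∀ (z : ℂ) (t : ℝ), ‖(f t : ℂ) * Complex.exp (-(z * t))‖
      = ‖f t‖ * exp (-(z.re * t)) := by
    intro z t
    rw [norm_mul, Complex.norm_real, Complex.norm_exp]
    simp
  refine (hasDerivAt_integral_of_dominated_loc_of_deriv_le (μ := volume.restrict (Set.Ioi 0))
    (s := Metric.ball z₀ ε)
    (F := fun (z : ℂ) (t : ℝ) => (f t : ℂ) * Complex.exp (-(z * t)))
    (F' := fun (z : ℂ) (t : ℝ) => (f t : ℂ) * Complex.exp (-(z * t)) * (-t))
    (bound := fun t => 1 / ε * ‖f t * exp (-(x₀ * t))‖)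
    (Metric.ball_mem_nhds z₀ hε0) ?_ ?_ ?_ ?_ ?_ ?_).2.differentiableAt.differentiableWithinAt
  · exact Eventually.of_forall hmeas
  · refine Integrable.mono hf (hmeas z₀) ?_
    filter_upwards [ae_restrict_mem measurableSet_Ioi] with t ht
    have ht' : 0 < t := ht
    rw [hnorm, norm_mul, norm_of_nonneg (exp_pos _).le]
    gcongr
  · exact (hmeas z₀).mul (by fun_prop : Continuous fun t : ℝ => (-t : ℂ)).aestronglyMeasurable
  · filter_upwards [ae_restrict_mem measurableSet_Ioi] with t ht z hz
    have ht' : 0 < t := ht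
    rw [norm_mul, hnorm, norm_neg, Complex.norm_real, norm_mul, norm_of_nonneg (exp_pos _).le,
      norm_of_nonneg ht'.le]
    have hzr : x₀ + ε ≤ z.re := by
      have h1 : |(z - z₀).re| ≤ ‖z - z₀‖ := Complex.abs_re_le_norm _
      have h2 : ‖z - z₀‖ < ε := by simpa [dist_eq_norm] using hz
      have h3 := (abs_le.1 (h1.trans h2.le)).1
      rw [Complex.sub_re] at h3
      linarith
    have h4 : ε * t ≤ exp (ε * t) := by linarith [add_one_le_exp (ε * t)]
    calc ‖f t‖ * exp (-(z.re * t)) * t ≤ ‖f t‖ * exp (-((x₀ + ε) * t)) * t := by gcongr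
      _ = 1 / ε * (‖f t‖ * (exp (-(x₀ * t)) * (exp (-(ε * t)) * (ε * t)))) := by
        rw [show -((x₀ + ε) * t) = -(x₀ * t) + -(ε * t) by ring, exp_add]
        field_simp
      _ ≤ 1 / ε * (‖f t‖ * (exp (-(x₀ * t)) * (exp (-(ε * t)) * exp (ε * t)))) := by gcongr
      _ = _ := by rw [← exp_add (-(ε * t))]; simp
  · exact (hf.norm).const_mul _
  · refine ae_of_all _ fun t z _ => ?_
    have := ((hasDerivAt_id z).mul_const (t : ℂ)).neg.cexp.const_mul (f t : ℂ)
    refine this.congr_deriv ?_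
    simp
    ring


lemma abs_log_im_le_pi (z : ℂ) : |(Complex.log z).im| ≤ π := by
  rw [Complex.log_im]
  exact Complex.abs_arg_le_pi z

/-- The Laplace exponent `C₁ z^{a₁} + C₂ z^{a₂}` of the mixed stable subordinator as a function of
a logarithm `w` of `z`. -/
noncomputable def laplaceExp (a1 a2 C1 C2 : ℝ) (w : ℂ) : ℂ :=
  C1 * Complex.exp (a1 * w) + C2 * Complex.exp (a2 * w)

lemma differentiable_laplaceExp : Differentiable ℂ (laplaceExp a1 a2 C1 C2) := by
  unfold laplaceExp
  fun_prop

lemma norm_laplaceExp_ge (ha2 : 0 < a2) (ha12 : a2 < a1) (ha1 : a1 < 1) (hC1 : 0 < C1)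
    (hC2 : 0 < C2) {w : ℂ} (hw : |w.im| ≤ π) :
    cos ((a1 - a2) * π / 2) * (C1 * exp (a1 * w.re) + C2 * exp (a2 * w.re))
      ≤ ‖laplaceExp a1 a2 C1 C2 w‖ := by
  set ψ := (a1 - a2) * w.im / 2 with hψ
  have hcos : cos ((a1 - a2) * π / 2) ≤ cos ψ := by
    rw [← cos_abs ψ]
    refine cos_le_cos_of_nonneg_of_le_pi (abs_nonneg _) ?_ ?_
    · nlinarith [pi_pos]
    · rw [hψ, abs_div, abs_mul, abs_of_pos (by linarith : 0 < a1 - a2), abs_two]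
      have : 0 ≤ a1 - a2 := by linarith
      gcongr
  set r : ℂ := Complex.exp (-(((a1 + a2) / 2 * w.im : ℝ) : ℂ) * Complex.I) with hr
  have hrn : ‖r‖ = 1 := by
    rw [hr, ← Complex.ofReal_neg]
    exact Complex.norm_exp_ofReal_mul_I _
  have hre : (r * laplaceExp a1 a2 C1 C2 w).re
      = cos ψ * (C1 * exp (a1 * w.re) + C2 * exp (a2 * w.re)) := by
    have e : r * laplaceExp a1 a2 C1 C2 w
        = C1 * Complex.exp (-(((a1 + a2) / 2 * w.im : ℝ) : ℂ) * Complex.I + a1 * w)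
          + C2 * Complex.exp (-(((a1 + a2) / 2 * w.im : ℝ) : ℂ) * Complex.I + a2 * w) := by
      rw [laplaceExp, hr, Complex.exp_add, Complex.exp_add]
      ring
    rw [e, Complex.add_re, Complex.re_ofReal_mul, Complex.re_ofReal_mul, Complex.exp_re,
      Complex.exp_re]
    have i1 : (-(((a1 + a2) / 2 * w.im : ℝ) : ℂ) * Complex.I + a1 * w).im = ψ := by
      simp [hψ]
      ring
    have i2 : (-(((a1 + a2) / 2 * w.im : ℝ) : ℂ) * Complex.I + a2 * w).im = -ψ := by
      simp [hψ]
      ring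
    have r1 : (-(((a1 + a2) / 2 * w.im : ℝ) : ℂ) * Complex.I + a1 * w).re = a1 * w.re := by
      simp
    have r2 : (-(((a1 + a2) / 2 * w.im : ℝ) : ℂ) * Complex.I + a2 * w).re = a2 * w.re := by
      simp
    rw [i1, i2, r1, r2, cos_neg]
    ring
  calc _ ≤ cos ψ * (C1 * exp (a1 * w.re) + C2 * exp (a2 * w.re)) := by gcongr
    _ = (r * laplaceExp a1 a2 C1 C2 w).re := hre.symm
    _ ≤ ‖r * laplaceExp a1 a2 C1 C2 w‖ := Complex.re_le_norm _
    _ = _ := by rw [norm_mul, hrn, one_mul]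

lemma cos_half_pos (ha2 : 0 < a2) (ha12 : a2 < a1) (ha1 : a1 < 1) :
    0 < cos ((a1 - a2) * π / 2) := by
  refine cos_pos_of_mem_Ioo ⟨?_, ?_⟩ <;> nlinarith [pi_pos]

lemma laplaceExp_ne_zero (ha2 : 0 < a2) (ha12 : a2 < a1) (ha1 : a1 < 1) (hC1 : 0 < C1)
    (hC2 : 0 < C2) {w : ℂ} (hw : |w.im| ≤ π) : laplaceExp a1 a2 C1 C2 w ≠ 0 := by
  have h := norm_laplaceExp_ge ha2 ha12 ha1 hC1 hC2 hw
  have hc := cos_half_pos ha2 ha12 ha1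
  rw [← norm_pos_iff]
  exact lt_of_lt_of_le (by positivity) h

lemma Ufun_laplace (ha2 : 0 < a2) (ha12 : a2 < a1) (ha1 : a1 < 1) (hC1 : 0 < C1) (hC2 : 0 < C2)
    {x₀ : ℝ} (hx₀ : 0 < x₀) (hxa : C2 / C1 < x₀ ^ (a1 - a2)) {z : ℂ} (hz : x₀ < z.re) :
    ∫ t in Set.Ioi (0 : ℝ), (Ufun a1 a2 C1 C2 t : ℂ) * Complex.exp (-(z * t))
      = 1 / (z * laplaceExp a1 a2 C1 C2 (Complex.log z)) := by
  have hopen : IsOpen {z : ℂ | x₀ < z.re} := isOpen_lt continuous_const Complex.continuous_re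
  have hL := (differentiableOn_laplace (Ufun_laplace_real ha2 ha12 hC1 hC2 hx₀ hxa).1
    (continuous_Ufun ha2 ha12).aestronglyMeasurable).analyticOnNhd hopen
  have hpos : ∀ w ∈ {z : ℂ | x₀ < z.re}, w ∈ Complex.slitPlane := fun w hw =>
    Or.inl (hx₀.trans hw)
  have hR : AnalyticOnNhd ℂ (fun z => 1 / (z * laplaceExp a1 a2 C1 C2 (Complex.log z)))
      {z : ℂ | x₀ < z.re} := by
    refine DifferentiableOn.analyticOnNhd (fun w hw => ?_) hopen
    refine DifferentiableAt.differentiableWithinAt ?_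
    refine (differentiableAt_const _).div (differentiableAt_id.mul
      (differentiable_laplaceExp.differentiableAt.comp w
        (Complex.differentiableAt_log (hpos w hw)))) ?_
    exact mul_ne_zero (Complex.slitPlane_ne_zero (hpos w hw))
      (laplaceExp_ne_zero ha2 ha12 ha1 hC1 hC2 (abs_log_im_le_pi w))
  have hreal : ∀ x : ℝ, x₀ < x →
      ∫ t in Set.Ioi (0 : ℝ), (Ufun a1 a2 C1 C2 t : ℂ) * Complex.exp (-((x : ℂ) * t))
      = 1 / ((x : ℂ) * laplaceExp a1 a2 C1 C2 (Complex.log x)) := by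
    intro x hx
    have hx0 := hx₀.trans hx
    have h := (Ufun_laplace_real ha2 ha12 hC1 hC2 hx0
      (hxa.trans (rpow_lt_rpow hx₀.le hx (by linarith)))).2
    have h' := congrArg (fun r : ℝ => (r : ℂ)) h
    rw [← integral_complex_ofReal] at h'
    push_cast at h'
    rw [h', laplaceExp, ← Complex.ofReal_log hx0.le, rpow_def_of_pos hx0, rpow_def_of_pos hx0]
    push_cast
    ring_nf
  refine hL.eqOn_of_preconnected_of_frequently_eq hR
    (convex_halfSpace_re_gt x₀).isPreconnected (z₀ := ((x₀ + 1 : ℝ) : ℂ)) (by simp) ?_ hz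
  have hseq : Tendsto (fun n : ℕ => ((x₀ + 1 + 1 / ((n : ℝ) + 1) : ℝ) : ℂ)) atTop
      (𝓝[≠] ((x₀ + 1 : ℝ) : ℂ)) := by
    refine tendsto_nhdsWithin_iff.2 ⟨?_, ?_⟩
    · refine (Complex.continuous_ofReal.tendsto _).comp ?_
      simpa using (tendsto_one_div_add_atTop_nhds_zero_nat (𝕜 := ℝ)).const_add (x₀ + 1)
    · refine Eventually.of_forall fun n => ?_
      have : (0 : ℝ) < 1 / ((n : ℝ) + 1) := by positivity
      simp only [Set.mem_compl_iff, Set.mem_singleton_iff, Complex.ofReal_inj]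
      linarith
  refine hseq.frequently (Eventually.of_forall fun n => ?_).frequently
  have : (0 : ℝ) < 1 / ((n : ℝ) + 1) := by positivity
  exact hreal _ (by linarith)

lemma norm_inv_mul_laplaceExp_le (ha2 : 0 < a2) (ha12 : a2 < a1) (ha1 : a1 < 1) (hC1 : 0 < C1)
    (hC2 : 0 < C2) {z w : ℂ} (hz : z ≠ 0) (hw : |w.im| ≤ π) (hzw : w.re = log ‖z‖) :
    ‖1 / (z * laplaceExp a1 a2 C1 C2 w)‖
      ≤ 1 / (cos ((a1 - a2) * π / 2) * C1) * ‖z‖ ^ (-(1 + a1)) := by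
  have h := norm_laplaceExp_ge ha2 ha12 ha1 hC1 hC2 hw
  have hc := cos_half_pos ha2 ha12 ha1
  have hz' : 0 < ‖z‖ := norm_pos_iff.2 hz
  have h1 : cos ((a1 - a2) * π / 2) * C1 * ‖z‖ ^ a1 ≤ ‖laplaceExp a1 a2 C1 C2 w‖ := by
    refine le_trans ?_ h
    rw [hzw, rpow_def_of_pos hz', mul_comm a1, mul_assoc]
    gcongr
    have : 0 < C2 * exp (a2 * log ‖z‖) := by positivity
    linarith
  rw [norm_div, norm_mul, norm_one, rpow_neg hz'.le, rpow_add hz', rpow_one, ← div_eq_mul_inv,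
    div_div]
  refine one_div_le_one_div_of_le (by positivity) ?_
  calc _ = ‖z‖ * (cos ((a1 - a2) * π / 2) * C1 * ‖z‖ ^ a1) := by ring
    _ ≤ _ := by gcongr

lemma integrable_vertical (ha2 : 0 < a2) (ha12 : a2 < a1) (ha1 : a1 < 1) (hC1 : 0 < C1)
    (hC2 : 0 < C2) {c : ℝ} (hc : 0 < c) :
    Integrable fun y : ℝ => 1 / ((c + y * Complex.I) *
      laplaceExp a1 a2 C1 C2 (Complex.log (c + y * Complex.I))) := by
  have hcz : ∀ y : ℝ, (c + y * Complex.I : ℂ) ≠ 0 := fun y h => by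
    have := congrArg Complex.re h
    simp at this
    exact hc.ne' this
  have hintg : Integrable fun y : ℝ => 1 / (cos ((a1 - a2) * π / 2) * C1) *
      ((1 / c + 1) ^ (1 + a1) * (1 + ‖y‖) ^ (-(1 + a1))) := by
    refine ((integrable_one_add_norm ?_).const_mul _).const_mul _
    simp
    linarith
  refine hintg.mono' ?_ (ae_of_all _ fun y => ?_)
  · refine Continuous.aestronglyMeasurable ?_
    rw [continuous_iff_continuousAt]
    intro y
    refine ContinuousAt.div continuousAt_const (ContinuousAt.mul (by fun_prop) ?_) ?_
    · refine (differentiable_laplaceExp.continuous.continuousAt).comp ?_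
      refine ContinuousAt.clog (by fun_prop) (Or.inl (by simpa using hc))
    · exact mul_ne_zero (hcz y)
        (laplaceExp_ne_zero ha2 ha12 ha1 hC1 hC2 (abs_log_im_le_pi _))
  · refine (norm_inv_mul_laplaceExp_le ha2 ha12 ha1 hC1 hC2 (hcz y)
      (abs_log_im_le_pi _) (Complex.log_re _)).trans ?_
    have hz' : 0 < ‖(c + y * Complex.I : ℂ)‖ := norm_pos_iff.2 (hcz y)
    have h1 : c ≤ ‖(c + y * Complex.I : ℂ)‖ := by
      simpa using Complex.re_le_norm (c + y * Complex.I : ℂ)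
    have h2 : ‖y‖ ≤ ‖(c + y * Complex.I : ℂ)‖ := by
      simpa using Complex.abs_im_le_norm (c + y * Complex.I : ℂ)
    have hcp := cos_half_pos ha2 ha12 ha1
    refine mul_le_mul_of_nonneg_left ?_ (by positivity)
    have h3 : 1 + ‖y‖ ≤ (1 / c + 1) * ‖(c + y * Complex.I : ℂ)‖ := by
      have : 1 ≤ 1 / c * ‖(c + y * Complex.I : ℂ)‖ := by
        rw [one_div, ← div_eq_inv_mul, one_le_div hc]
        exact h1
      linarith
    have h4 : (1 + ‖y‖) ^ (1 + a1) ≤ (1 / c + 1) ^ (1 + a1) *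
        ‖(c + y * Complex.I : ℂ)‖ ^ (1 + a1) := by
      rw [← mul_rpow (by positivity) hz'.le]
      exact rpow_le_rpow (by positivity) h3 (by linarith)
    rw [rpow_neg hz'.le, rpow_neg (by positivity), ← div_eq_mul_inv, inv_eq_one_div,
      div_le_div_iff₀ (by positivity) (by positivity)]
    linarith

lemma Ufun_bromwich (ha2 : 0 < a2) (ha12 : a2 < a1) (ha1 : a1 < 1) (hC1 : 0 < C1) (hC2 : 0 < C2)
    {x₀ c : ℝ} (hx₀ : 0 < x₀) (hxa : C2 / C1 < x₀ ^ (a1 - a2)) (hc : x₀ < c) {t : ℝ} (ht : 0 < t) :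
    (Ufun a1 a2 C1 C2 t : ℂ) = (2 * π : ℝ)⁻¹ * ∫ y : ℝ, Complex.exp ((c + y * Complex.I) * t) *
      (1 / ((c + y * Complex.I) *
        laplaceExp a1 a2 C1 C2 (Complex.log (c + y * Complex.I)))) := by
  have hc0 := hx₀.trans hc
  set f : ℝ → ℂ := (Set.Ioi (0 : ℝ)).indicator
    (fun t => (Ufun a1 a2 C1 C2 t : ℂ) * Complex.exp (-(c * t))) with hf
  set H : ℝ → ℂ := fun y => 1 / ((c + y * Complex.I) *
      laplaceExp a1 a2 C1 C2 (Complex.log (c + y * Complex.I))) with hH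
  have hcf : Continuous fun t : ℝ => (Ufun a1 a2 C1 C2 t : ℂ) * Complex.exp (-(c * t)) := by
    have := continuous_Ufun (C1 := C1) (C2 := C2) ha2 ha12
    fun_prop
  have hfi : Integrable f := by
    rw [hf, integrable_indicator_iff measurableSet_Ioi]
    have := (Ufun_laplace_real ha2 ha12 hC1 hC2 hc0
      (hxa.trans (rpow_lt_rpow hx₀.le hc (by linarith)))).1.ofReal (𝕜 := ℂ)
    refine this.congr (ae_of_all _ fun t => ?_)
    simp
  have hF : FourierTransform.fourier f = fun w => H (2 * π * w) := by
    ext w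
    rw [Real.fourier_real_eq_integral_exp_smul]
    have e : ∀ v : ℝ, Complex.exp (↑(-2 * π * v * w) * Complex.I) • f v
        = (Set.Ioi (0 : ℝ)).indicator (fun t : ℝ => (Ufun a1 a2 C1 C2 t : ℂ) *
          Complex.exp (-((c + (2 * π * w : ℝ) * Complex.I) * t))) v := by
      intro v
      by_cases hv : v ∈ Set.Ioi (0 : ℝ)
      · rw [hf, Set.indicator_of_mem hv, Set.indicator_of_mem hv, smul_eq_mul, mul_left_comm,
          ← Complex.exp_add]
        push_cast
        ring_nf
      · rw [hf, Set.indicator_of_notMem hv, Set.indicator_of_notMem hv, smul_zero]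
    simp_rw [e]
    rw [integral_indicator measurableSet_Ioi,
      Ufun_laplace ha2 ha12 ha1 hC1 hC2 hx₀ hxa (by simpa using hc)]
  have hHi : Integrable H := integrable_vertical ha2 ha12 ha1 hC1 hC2 hc0
  have hpi : (2 * π : ℝ) ≠ 0 := by positivity
  have hinv := hfi.fourierInv_fourier_eq (by rw [hF]; exact hHi.comp_mul_left' hpi) (v := t) (by
    refine hcf.continuousAt.congr ?_
    filter_upwards [Ioi_mem_nhds ht] with x hx
    rw [hf, Set.indicator_of_mem hx])
  rw [Real.fourierInv_eq', hF] at hinv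
  have e2 : ∀ v : ℝ, Complex.exp (↑(2 * π * inner ℝ v t) * Complex.I) • H (2 * π * v)
      = (fun y : ℝ => Complex.exp (y * t * Complex.I) * H y) (2 * π * v) := by
    intro v
    simp only [smul_eq_mul, RCLike.inner_apply, conj_trivial]
    push_cast
    ring_nf
  rw [integral_congr_ae (ae_of_all _ e2), Measure.integral_comp_mul_left
    (fun y : ℝ => Complex.exp (y * t * Complex.I) * H y), hf,
    Set.indicator_of_mem (Set.mem_Ioi.2 ht),
    abs_of_pos (by positivity)] at hinv
  have e3 : ∀ y : ℝ, Complex.exp ((c + y * Complex.I) * t) * H y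
      = Complex.exp (c * t) * (Complex.exp (y * t * Complex.I) * H y) := by
    intro y
    rw [← mul_assoc, ← Complex.exp_add]
    ring_nf
  calc (Ufun a1 a2 C1 C2 t : ℂ)
      = Complex.exp (c * t) * ((Ufun a1 a2 C1 C2 t : ℂ) * Complex.exp (-(c * t))) := by
        rw [mul_left_comm, ← Complex.exp_add]
        simp
    _ = (2 * π : ℝ)⁻¹ * ∫ y : ℝ, Complex.exp ((c + y * Complex.I) * t) * H y := by
        rw [← hinv]
        simp_rw [e3]
        rw [integral_const_mul, Complex.real_smul]
        ring


/-- The branch of the logarithm that is holomorphic on a neighbourhood of the closed upper half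
plane without the origin. -/
noncomputable def upperLog (z : ℂ) : ℂ := Complex.log (-Complex.I * z) + π / 2 * Complex.I

lemma upperLog_re (z : ℂ) : (upperLog z).re = log ‖z‖ := by
  simp [upperLog, Complex.log_re]

lemma abs_upperLog_im_le {z : ℂ} (hz : 0 ≤ z.im) : |(upperLog z).im| ≤ π := by
  have h : |Complex.arg (-Complex.I * z)| ≤ π / 2 := by
    rw [Complex.abs_arg_le_pi_div_two_iff]
    simpa using hz
  have e : (upperLog z).im = Complex.arg (-Complex.I * z) + π / 2 := by
    have : ((π : ℂ) / 2 * Complex.I).im = π / 2 := by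
      rw [show (π : ℂ) / 2 * Complex.I = ((π / 2 : ℝ) : ℂ) * Complex.I by push_cast; ring,
        Complex.im_ofReal_mul, Complex.I_im, mul_one]
    rw [upperLog, Complex.add_im, Complex.log_im, this]
  rw [e, abs_le]
  have := abs_le.1 h
  constructor <;> linarith [pi_pos]

lemma neg_I_mul_mem_slitPlane {z : ℂ} (hz : z ≠ 0) (him : 0 ≤ z.im) :
    -Complex.I * z ∈ Complex.slitPlane := by
  rw [Complex.mem_slitPlane_iff]
  rcases him.eq_or_lt with h | h
  · right
    simp only [Complex.mul_im, Complex.neg_re, Complex.I_re, Complex.neg_im, Complex.I_im]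
    intro h0
    exact hz (Complex.ext (by simp at h0; simpa using h0) (by simpa using h.symm))
  · left
    simpa using h

lemma upperLog_eq_log {z : ℂ} (hz : z ≠ 0) (him : 0 ≤ z.im) : upperLog z = Complex.log z := by
  have h1 := Complex.arg_nonneg_iff.2 him
  have h2 := Complex.arg_le_pi z
  rw [upperLog, Complex.log_mul (by simp) hz, Complex.log_neg_I]
  · ring
  · rw [Complex.arg_neg_I]
    constructor <;> linarith [pi_pos]

lemma upperLog_neg_ofReal {r : ℝ} (hr : 0 < r) :
    upperLog (-(r : ℂ)) = log r + π * Complex.I := by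
  rw [upperLog, show -Complex.I * -(r : ℂ) = Complex.I * r by ring,
    Complex.log_mul_ofReal r hr _ Complex.I_ne_zero, Complex.log_I]
  ring

/-- The integrand of the inversion formula for a mixed second difference of `Ufun`. -/
noncomputable def diffKernel (a1 a2 C1 C2 δ τ t : ℝ) (z : ℂ) : ℂ :=
  Complex.exp (t * z) * (Complex.exp (δ * z) - 1) * (Complex.exp (-τ * z) - 1) *
    (1 / (z * laplaceExp a1 a2 C1 C2 (upperLog z)))

lemma norm_diffKernel_le (ha2 : 0 < a2) (ha12 : a2 < a1) (ha1 : a1 < 1) (hC1 : 0 < C1)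
    (hC2 : 0 < C2) {δ τ t c : ℝ} (hδ : 0 ≤ δ) (hτ : 0 ≤ τ) (ht : τ ≤ t) (hc : 0 ≤ c) {z : ℂ}
    (hz : z ≠ 0) (him : 0 ≤ z.im) (hre : z.re ≤ c) :
    ‖diffKernel a1 a2 C1 C2 δ τ t z‖ ≤ 4 * exp ((t + δ) * c) *
      (1 / (cos ((a1 - a2) * π / 2) * C1) * ‖z‖ ^ (-(1 + a1))) := by
  have hexp : ∀ x : ℝ, 0 ≤ x → x ≤ t + δ → ‖Complex.exp (x * z)‖ ≤ exp ((t + δ) * c) := by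
    intro x hx hx'
    rw [Complex.norm_exp, Complex.re_ofReal_mul]
    refine exp_le_exp.2 ?_
    calc x * z.re ≤ x * c := by gcongr
      _ ≤ _ := by gcongr
  have e : Complex.exp (t * z) * (Complex.exp (δ * z) - 1) * (Complex.exp (-τ * z) - 1)
      = Complex.exp ((t + δ - τ : ℝ) * z) - Complex.exp ((t - τ : ℝ) * z)
        - Complex.exp ((t + δ : ℝ) * z) + Complex.exp ((t : ℝ) * z) := by
    push_cast
    rw [show (t + δ - τ : ℂ) * z = t * z + δ * z + -τ * z by ring,
      show (t - τ : ℂ) * z = t * z + -τ * z by ring,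
      show (t + δ : ℂ) * z = t * z + δ * z by ring]
    simp only [Complex.exp_add]
    ring
  rw [diffKernel, norm_mul, e]
  refine mul_le_mul ?_ (norm_inv_mul_laplaceExp_le ha2 ha12 ha1 hC1 hC2 hz
    (abs_upperLog_im_le him) (upperLog_re z)) (norm_nonneg _) (by positivity)
  have h1 := hexp (t + δ - τ) (by linarith) (by linarith)
  have h2 := hexp (t - τ) (by linarith) (by linarith)
  have h3 := hexp (t + δ) (by linarith) (by linarith)
  have h4 := hexp t (by linarith) (by linarith)
  refine (norm_add_le _ _).trans ?_
  have h5 := norm_sub_le (Complex.exp ((t + δ - τ : ℝ) * z) - Complex.exp ((t - τ : ℝ) * z))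
    (Complex.exp ((t + δ : ℝ) * z))
  have h6 := norm_sub_le (Complex.exp ((t + δ - τ : ℝ) * z)) (Complex.exp ((t - τ : ℝ) * z))
  linarith

lemma differentiableAt_diffKernel (ha2 : 0 < a2) (ha12 : a2 < a1) (ha1 : a1 < 1) (hC1 : 0 < C1)
    (hC2 : 0 < C2) {δ τ t : ℝ} {z : ℂ} (hz : z ≠ 0) (him : 0 ≤ z.im) :
    DifferentiableAt ℂ (diffKernel a1 a2 C1 C2 δ τ t) z := by
  have hlog : DifferentiableAt ℂ upperLog z := by
    unfold upperLog
    exact (DifferentiableAt.clog (by fun_prop) (neg_I_mul_mem_slitPlane hz him)).add_const _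
  have hP : DifferentiableAt ℂ (fun z => laplaceExp a1 a2 C1 C2 (upperLog z)) z :=
    differentiable_laplaceExp.differentiableAt.comp z hlog
  unfold diffKernel
  refine DifferentiableAt.mul (by fun_prop) ?_
  exact (differentiableAt_const _).div (differentiableAt_id.mul hP)
    (mul_ne_zero hz (laplaceExp_ne_zero ha2 ha12 ha1 hC1 hC2 (abs_upperLog_im_le him)))

lemma continuousWithinAt_diffKernel_zero (ha2 : 0 < a2) (ha12 : a2 < a1) (ha1 : a1 < 1)
    (hC1 : 0 < C1) (hC2 : 0 < C2) {δ τ t : ℝ} (hδ : 0 < δ) (hτ : 0 ≤ τ) (ht : 0 ≤ t) :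
    ContinuousWithinAt (diffKernel a1 a2 C1 C2 δ τ t) {z | 0 ≤ z.im} 0 := by
  have h0 : diffKernel a1 a2 C1 C2 δ τ t 0 = 0 := by simp [diffKernel]
  have hc := cos_half_pos ha2 ha12 ha1
  rw [ContinuousWithinAt, h0]
  have hlim : Tendsto (fun z : ℂ => exp t * (2 * δ) * (2 * τ) *
      (1 / (cos ((a1 - a2) * π / 2) * C2)) * ‖z‖ ^ (1 - a2)) (𝓝[{z | 0 ≤ z.im}] 0) (𝓝 0) := by
    have h1 : Continuous fun z : ℂ => ‖z‖ ^ (1 - a2) :=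
      continuous_norm.rpow_const fun _ => Or.inr (by linarith)
    have h2 := (h1.tendsto 0).const_mul (exp t * (2 * δ) * (2 * τ) *
      (1 / (cos ((a1 - a2) * π / 2) * C2)))
    rw [norm_zero, zero_rpow (by linarith), mul_zero] at h2
    exact h2.mono_left nhdsWithin_le_nhds
  refine squeeze_zero_norm' ?_ hlim
  have hnhds : Metric.ball (0 : ℂ) (1 / (1 + δ + τ)) ∈ 𝓝[{z | 0 ≤ z.im}] (0 : ℂ) :=
    nhdsWithin_le_nhds (Metric.ball_mem_nhds _ (by positivity))
  filter_upwards [hnhds, self_mem_nhdsWithin] with z hz him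
  rcases eq_or_ne z 0 with rfl | hz0
  · rw [h0, norm_zero]
    positivity
  have hz' : 0 < ‖z‖ := norm_pos_iff.2 hz0
  rw [Metric.mem_ball, dist_zero_right, lt_div_iff₀ (by positivity)] at hz
  have hz1 : ‖z‖ ≤ 1 := by nlinarith [mul_nonneg hz'.le hδ.le, mul_nonneg hz'.le hτ]
  have hzδ : ‖z‖ * δ ≤ 1 := by nlinarith [mul_nonneg hz'.le hτ]
  have hzτ : ‖z‖ * τ ≤ 1 := by nlinarith [mul_nonneg hz'.le hδ.le]
  have b1 : ‖Complex.exp (t * z)‖ ≤ exp t := by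
    rw [Complex.norm_exp, Complex.re_ofReal_mul]
    gcongr
    have : z.re ≤ 1 := (Complex.re_le_norm z).trans hz1
    nlinarith
  have n2 : ‖(δ * z : ℂ)‖ = ‖z‖ * δ := by
    rw [norm_mul, Complex.norm_real, norm_of_nonneg hδ.le, mul_comm]
  have n3 : ‖(-τ * z : ℂ)‖ = ‖z‖ * τ := by
    rw [norm_mul, norm_neg, Complex.norm_real, norm_of_nonneg hτ, mul_comm]
  have b2 : ‖Complex.exp (δ * z) - 1‖ ≤ 2 * (‖z‖ * δ) := by
    rw [← n2]
    exact Complex.norm_exp_sub_one_le (by rwa [n2])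
  have b3 : ‖Complex.exp (-τ * z) - 1‖ ≤ 2 * (‖z‖ * τ) := by
    rw [← n3]
    exact Complex.norm_exp_sub_one_le (by rwa [n3])
  have b4 : cos ((a1 - a2) * π / 2) * C2 * ‖z‖ ^ a2 ≤ ‖laplaceExp a1 a2 C1 C2 (upperLog z)‖ := by
    refine le_trans ?_ (norm_laplaceExp_ge ha2 ha12 ha1 hC1 hC2 (abs_upperLog_im_le him))
    rw [upperLog_re, rpow_def_of_pos hz', mul_comm (log ‖z‖), mul_assoc]
    gcongr
    have : 0 < C1 * exp (a1 * log ‖z‖) := by positivity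
    linarith
  rw [diffKernel, norm_mul, norm_mul, norm_mul, norm_div, norm_one, norm_mul]
  calc _ ≤ exp t * (2 * (‖z‖ * δ)) * (2 * (‖z‖ * τ)) *
        (1 / (‖z‖ * (cos ((a1 - a2) * π / 2) * C2 * ‖z‖ ^ a2))) := by gcongr
    _ = _ := by
      rw [rpow_sub hz', rpow_one]
      field_simp

lemma continuousOn_diffKernel (ha2 : 0 < a2) (ha12 : a2 < a1) (ha1 : a1 < 1)
    (hC1 : 0 < C1) (hC2 : 0 < C2) {δ τ t : ℝ} (hδ : 0 < δ) (hτ : 0 ≤ τ) (ht : 0 ≤ t) :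
    ContinuousOn (diffKernel a1 a2 C1 C2 δ τ t) {z | 0 ≤ z.im} := by
  intro z hz
  rcases eq_or_ne z 0 with rfl | hz0
  · exact continuousWithinAt_diffKernel_zero ha2 ha12 ha1 hC1 hC2 hδ hτ ht
  · exact (differentiableAt_diffKernel ha2 ha12 ha1 hC1 hC2 hz0 hz).continuousAt.continuousWithinAt

lemma diffKernel_ofReal_im {δ τ t x : ℝ} (hx : 0 ≤ x) :
    (diffKernel a1 a2 C1 C2 δ τ t x).im = 0 := by
  rcases hx.eq_or_lt with rfl | hx
  · simp [diffKernel]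
  · rw [diffKernel, upperLog_eq_log (by exact_mod_cast hx.ne') (by simp), laplaceExp,
      ← Complex.ofReal_log hx.le]
    norm_cast

/-- Minus the imaginary part of `1 / (C₁ z^{a₁} + C₂ z^{a₂})` at the upper edge of the cut. -/
noncomputable def cutDensity (a1 a2 C1 C2 r : ℝ) : ℝ :=
  -(1 / laplaceExp a1 a2 C1 C2 (log r + π * Complex.I)).im

lemma diffKernel_neg_ofReal_im {δ τ t r : ℝ} (hr : 0 < r) :
    (diffKernel a1 a2 C1 C2 δ τ t (-(r : ℂ))).im
      = -(exp (-(t * r)) * (1 - exp (-(δ * r))) * (exp (τ * r) - 1) / r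
        * cutDensity a1 a2 C1 C2 r) := by
  have e : diffKernel a1 a2 C1 C2 δ τ t (-(r : ℂ))
      = ((exp (-(t * r)) * (1 - exp (-(δ * r))) * (exp (τ * r) - 1) / r : ℝ) : ℂ) *
        (1 / laplaceExp a1 a2 C1 C2 (log r + π * Complex.I)) := by
    rw [diffKernel, upperLog_neg_ofReal hr]
    push_cast
    rw [show (t : ℂ) * -r = -(t * r) by ring, show (δ : ℂ) * -r = -(δ * r) by ring,
      show -(τ : ℂ) * -r = τ * r by ring]
    ring
  rw [e, Complex.im_ofReal_mul, cutDensity]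
  ring

lemma abs_cutDensity_le (ha2 : 0 < a2) (ha12 : a2 < a1) (ha1 : a1 < 1)
    (hC1 : 0 < C1) (hC2 : 0 < C2) {r : ℝ} (hr : 0 < r) :
    |cutDensity a1 a2 C1 C2 r| ≤ 1 / (cos ((a1 - a2) * π / 2) * C2) * r ^ (-a2) := by
  have hc := cos_half_pos ha2 ha12 ha1
  have him : ((log r : ℂ) + π * Complex.I).im = π := by simp
  have hre : ((log r : ℂ) + π * Complex.I).re = log r := by simp
  have h := norm_laplaceExp_ge ha2 ha12 ha1 hC1 hC2 (w := log r + π * Complex.I)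
    (by rw [him, abs_of_pos pi_pos])
  rw [hre] at h
  rw [cutDensity, abs_neg]
  refine (Complex.abs_im_le_norm _).trans ?_
  rw [norm_div, norm_one, rpow_neg hr.le, ← div_eq_mul_inv, div_div]
  refine one_div_le_one_div_of_le (by positivity) (le_trans ?_ h)
  rw [rpow_def_of_pos hr, mul_comm (log r), mul_assoc]
  gcongr
  have : 0 < C1 * exp (a1 * log r) := by positivity
  linarith

lemma abs_cut_integrand_le (ha2 : 0 < a2) (ha12 : a2 < a1) (ha1 : a1 < 1)
    (hC1 : 0 < C1) (hC2 : 0 < C2) {δ τ t r : ℝ} (hδ : 0 < δ) (hτ : 0 ≤ τ) (hr : 0 < r) :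
    |exp (-(t * r)) * (1 - exp (-(δ * r))) * (exp (τ * r) - 1) / r * cutDensity a1 a2 C1 C2 r|
      ≤ δ * τ / (cos ((a1 - a2) * π / 2) * C2) * (r ^ (2 - a2 - 1) * exp (-((t - τ) * r))) := by
  have hc := cos_half_pos ha2 ha12 ha1
  have h1 : 0 ≤ 1 - exp (-(δ * r)) := by
    rw [sub_nonneg, exp_le_one_iff]
    have := mul_pos hδ hr
    linarith
  have h1' : 1 - exp (-(δ * r)) ≤ δ * r := by linarith [add_one_le_exp (-(δ * r))]
  have h2 : 0 ≤ exp (τ * r) - 1 := by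
    rw [sub_nonneg, one_le_exp_iff]
    positivity
  have h2' : exp (τ * r) - 1 ≤ τ * r * exp (τ * r) := by
    have := add_one_le_exp (-(τ * r))
    have h3 : exp (τ * r) * (-(τ * r) + 1) ≤ exp (τ * r) * exp (-(τ * r)) := by gcongr
    rw [← exp_add, add_neg_cancel, exp_zero] at h3
    linarith
  rw [abs_mul, abs_of_nonneg (by positivity)]
  calc _ ≤ exp (-(t * r)) * (δ * r) * (τ * r * exp (τ * r)) / r *
        (1 / (cos ((a1 - a2) * π / 2) * C2) * r ^ (-a2)) := by
        gcongr
        exact abs_cutDensity_le ha2 ha12 ha1 hC1 hC2 hr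
    _ = _ := by
        rw [show -((t - τ) * r) = -(t * r) + τ * r by ring, exp_add,
          show 2 - a2 - 1 = 1 + -a2 by ring, rpow_add hr, rpow_one]
        field_simp

lemma integrableOn_rpow_mul_exp_neg_mul {p x : ℝ} (hp : 0 < p) (hx : 0 < x) :
    IntegrableOn (fun r : ℝ => r ^ (p - 1) * exp (-(x * r))) (Set.Ioi 0) := by
  refine Integrable.of_integral_ne_zero ?_
  rw [integral_rpow_mul_exp_neg_mul_Ioi hp hx]
  have := Gamma_pos_of_pos hp
  positivity

lemma measurable_cutDensity : Measurable (cutDensity a1 a2 C1 C2) := by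
  unfold cutDensity laplaceExp
  fun_prop

lemma integrableOn_cut_integrand (ha2 : 0 < a2) (ha12 : a2 < a1) (ha1 : a1 < 1)
    (hC1 : 0 < C1) (hC2 : 0 < C2) {δ τ t : ℝ} (hδ : 0 < δ) (hτ : 0 ≤ τ) (ht : τ < t) :
    IntegrableOn (fun r => exp (-(t * r)) * (1 - exp (-(δ * r))) * (exp (τ * r) - 1) / r *
      cutDensity a1 a2 C1 C2 r) (Set.Ioi 0) := by
  refine Integrable.mono' ((integrableOn_rpow_mul_exp_neg_mul (p := 2 - a2) (x := t - τ)
    (by linarith) (by linarith)).const_mul (δ * τ / (cos ((a1 - a2) * π / 2) * C2))) ?_ ?_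
  · have := measurable_cutDensity (a1 := a1) (a2 := a2) (C1 := C1) (C2 := C2)
    exact Measurable.aestronglyMeasurable (by fun_prop)
  · filter_upwards [ae_restrict_mem measurableSet_Ioi] with r hr
    exact abs_cut_integrand_le ha2 ha12 ha1 hC1 hC2 hδ hτ hr


lemma tendsto_re_vertical_add_cut (ha2 : 0 < a2) (ha12 : a2 < a1) (ha1 : a1 < 1)
    (hC1 : 0 < C1) (hC2 : 0 < C2) {δ τ t c : ℝ} (hδ : 0 < δ) (hτ : 0 ≤ τ) (ht : τ < t)
    (hc : 0 < c) :
    Tendsto (fun R : ℝ =>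
      (∫ y in (0 : ℝ)..R, (diffKernel a1 a2 C1 C2 δ τ t (c + y * Complex.I)).re)
      + ∫ r in (0 : ℝ)..R, (diffKernel a1 a2 C1 C2 δ τ t (-(r : ℂ))).im) atTop (𝓝 0) := by
  set g := diffKernel a1 a2 C1 C2 δ τ t with hg
  have hcont : ContinuousOn g {z | 0 ≤ z.im} :=
    continuousOn_diffKernel ha2 ha12 ha1 hC1 hC2 hδ hτ (hτ.trans ht.le)
  set B := 4 * exp ((t + δ) * c) * (1 / (cos ((a1 - a2) * π / 2) * C1)) with hB
  have hcos := cos_half_pos ha2 ha12 ha1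
  have hB0 : 0 ≤ B := by positivity
  have hbound : ∀ {R : ℝ} {z : ℂ}, 0 < R → R ≤ ‖z‖ → 0 ≤ z.im → z.re ≤ c →
      ‖g z‖ ≤ B * R ^ (-(1 + a1)) := by
    intro R z hR hRz him hre
    have hz : z ≠ 0 := norm_pos_iff.1 (hR.trans_le hRz)
    refine (norm_diffKernel_le ha2 ha12 ha1 hC1 hC2 hδ.le hτ ht.le hc.le hz him hre).trans ?_
    rw [← mul_assoc]
    refine mul_le_mul_of_nonneg_left ?_ hB0
    exact rpow_le_rpow_of_nonpos hR hRz (by linarith)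
  have hintg : ∀ {γ : ℝ → ℂ} (a b : ℝ), Continuous γ → (∀ x ∈ Set.uIcc a b, 0 ≤ (γ x).im) →
      IntervalIntegrable (fun x => g (γ x)) volume a b := fun a b hγ h =>
    (hcont.comp hγ.continuousOn h).intervalIntegrable
  have hid : ∀ R : ℝ, 0 < R →
      (∫ y in (0 : ℝ)..R, (g (c + y * Complex.I)).re) + ∫ r in (0 : ℝ)..R, (g (-(r : ℂ))).im
      = (∫ x in (-R)..c, g (x + R * Complex.I)).im
        + (∫ y in (0 : ℝ)..R, g ((-R : ℝ) + y * Complex.I)).re := by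
    intro R hR
    have hC := Complex.integral_boundary_rect_eq_zero_of_continuousOn_of_differentiableOn g
      ((-R : ℝ) : ℂ) (c + R * Complex.I) ?_ ?_
    · simp only [Complex.ofReal_re, Complex.ofReal_im, Complex.add_re, Complex.add_im,
        Complex.mul_re, Complex.mul_im, Complex.I_re, Complex.I_im, mul_zero, mul_one, sub_zero,
        zero_add, add_zero, Complex.ofReal_zero, zero_mul, smul_eq_mul] at hC
      have hC' := congrArg Complex.im hC
      simp only [Complex.sub_im, Complex.add_im, Complex.I_mul_im, Complex.zero_im] at hC'
      have hreal : ∀ x ∈ Set.uIcc (0 : ℝ) R, 0 ≤ x := fun x hx => by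
        rw [Set.uIcc_of_le hR.le] at hx
        exact hx.1
      have e1 : (∫ y in (0 : ℝ)..R, g (c + y * Complex.I)).re
          = ∫ y in (0 : ℝ)..R, (g (c + y * Complex.I)).re :=
        (Complex.reCLM.intervalIntegral_comp_comm
          (hintg 0 R (by fun_prop) fun x hx => by simpa using hreal x hx)).symm
      have e2 : (∫ x in (-R)..c, g (x : ℂ)).im = ∫ x in (-R)..c, (g (x : ℂ)).im :=
        (Complex.imCLM.intervalIntegral_comp_comm
          (hintg (-R) c (by fun_prop) fun x _ => by simp)).symm
      have hii : ∀ a b : ℝ, IntervalIntegrable (fun x : ℝ => (g (x : ℂ)).im) volume a b :=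
        fun a b => (Complex.continuous_im.comp_continuousOn (hcont.comp
          Complex.continuous_ofReal.continuousOn fun x _ => by simp)).intervalIntegrable
      have e3 : ∫ x in (-R)..c, (g (x : ℂ)).im = ∫ r in (0 : ℝ)..R, (g (-(r : ℂ))).im := by
        have h0 : ∫ x in (0 : ℝ)..c, (g (x : ℂ)).im = 0 := by
          rw [intervalIntegral.integral_congr (g := fun _ => 0)]
          · simp
          · intro x hx
            rw [Set.uIcc_of_le hc.le] at hx
            exact diffKernel_ofReal_im hx.1
        rw [← intervalIntegral.integral_add_adjacent_intervals (hii (-R) 0) (hii 0 c), h0, add_zero]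
        have := intervalIntegral.integral_comp_neg (a := 0) (b := R)
          (fun x : ℝ => (g (x : ℂ)).im)
        rw [neg_zero] at this
        rw [← this]
        simp
      rw [e1, e2, e3] at hC'
      linarith
    · refine hcont.mono fun z hz => ?_
      have := hz.2
      simp [Set.uIcc_of_le hR.le] at this
      exact this.1
    · intro z hz
      have := hz.2
      simp [min_eq_left hR.le] at this
      have him : 0 < z.im := this.1
      refine (differentiableAt_diffKernel ha2 ha12 ha1 hC1 hC2 ?_ him.le).differentiableWithinAt
      rintro rfl
      simp at him
  have hlim : Tendsto (fun R : ℝ => B * (2 * R ^ (-a1) + c * R ^ (-(1 + a1)))) atTop (𝓝 0) := by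
    have h1 := (tendsto_rpow_neg_atTop (ha2.trans ha12)).const_mul 2
    have h2 := (tendsto_rpow_neg_atTop (by linarith : 0 < 1 + a1)).const_mul c
    simpa using (h1.add h2).const_mul B
  refine squeeze_zero_norm' ?_ hlim
  filter_upwards [eventually_gt_atTop 0] with R hR
  rw [hid R hR]
  have htop : ‖∫ x in (-R)..c, g (x + R * Complex.I)‖ ≤ B * R ^ (-(1 + a1)) * |c - -R| := by
    refine intervalIntegral.norm_integral_le_of_norm_le_const fun x hx => ?_
    rw [Set.uIoc_of_le (by linarith)] at hx
    refine hbound hR ?_ (by simpa using hR.le) (by simpa using hx.2)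
    calc R = |(x + R * Complex.I : ℂ).im| := by simp [abs_of_pos hR]
      _ ≤ _ := Complex.abs_im_le_norm _
  have hleft : ‖∫ y in (0 : ℝ)..R, g ((-R : ℝ) + y * Complex.I)‖
      ≤ B * R ^ (-(1 + a1)) * |R - 0| := by
    refine intervalIntegral.norm_integral_le_of_norm_le_const fun y hy => ?_
    rw [Set.uIoc_of_le hR.le] at hy
    refine hbound hR ?_ (by simpa using hy.1.le) (by simp; linarith)
    calc R = |((-R : ℝ) + y * Complex.I : ℂ).re| := by simp [abs_of_pos hR]
      _ ≤ _ := Complex.abs_re_le_norm _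
  rw [abs_of_pos (by linarith)] at htop
  rw [sub_zero, abs_of_pos hR] at hleft
  refine (norm_add_le _ _).trans ?_
  have h1 := (Complex.abs_im_le_norm _).trans htop
  have h2 := (Complex.abs_re_le_norm _).trans hleft
  have h3 : R ^ (-(1 + a1)) * R = R ^ (-a1) := by
    rw [← rpow_add_one hR.ne']
    ring_nf
  rw [norm_eq_abs, norm_eq_abs]
  calc _ ≤ B * R ^ (-(1 + a1)) * (c - -R) + B * R ^ (-(1 + a1)) * R := add_le_add h1 h2
    _ = B * (2 * (R ^ (-(1 + a1)) * R) + c * R ^ (-(1 + a1))) := by ring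
    _ = _ := by rw [h3]

lemma Ufun_bromwich_half (ha2 : 0 < a2) (ha12 : a2 < a1) (ha1 : a1 < 1) (hC1 : 0 < C1)
    (hC2 : 0 < C2) {x₀ c : ℝ} (hx₀ : 0 < x₀) (hxa : C2 / C1 < x₀ ^ (a1 - a2)) (hc : x₀ < c)
    {t : ℝ} (ht : 0 < t) :
    IntegrableOn (fun y : ℝ => Complex.exp (t * (c + y * Complex.I)) *
      (1 / ((c + y * Complex.I) *
        laplaceExp a1 a2 C1 C2 (upperLog (c + y * Complex.I))))) (Set.Ioi 0) ∧
    Ufun a1 a2 C1 C2 t = π⁻¹ * ∫ y in Set.Ioi (0 : ℝ), (Complex.exp (t * (c + y * Complex.I)) *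
      (1 / ((c + y * Complex.I) *
        laplaceExp a1 a2 C1 C2 (upperLog (c + y * Complex.I))))).re := by
  have hc0 := hx₀.trans hc
  set h : ℝ → ℂ := fun y => Complex.exp ((c + y * Complex.I) * t) * (1 / ((c + y * Complex.I) *
        laplaceExp a1 a2 C1 C2 (Complex.log (c + y * Complex.I)))) with hh
  have hcz : ∀ y : ℝ, (c + y * Complex.I : ℂ) ≠ 0 := fun y h => by
    have := congrArg Complex.re h
    simp at this
    exact hc0.ne' this
  have heq : ∀ y ∈ Set.Ioi (0 : ℝ), h y = Complex.exp (t * (c + y * Complex.I)) *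
      (1 / ((c + y * Complex.I) *
        laplaceExp a1 a2 C1 C2 (upperLog (c + y * Complex.I)))) := by
    intro y hy
    have hy' : 0 < y := hy
    rw [hh, upperLog_eq_log (hcz y) (by simpa using hy'.le), mul_comm (t : ℂ)]
  have hhi : Integrable h := by
    refine (integrable_vertical ha2 ha12 ha1 hC1 hC2 hc0).bdd_mul (c := exp (c * t)) ?_ ?_
    · exact Continuous.aestronglyMeasurable (by fun_prop)
    · refine ae_of_all _ fun y => ?_
      rw [Complex.norm_exp]
      simp
  constructor
  · exact hhi.integrableOn.congr_fun heq measurableSet_Ioi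
  · have hB := congrArg Complex.re (Ufun_bromwich ha2 ha12 ha1 hC1 hC2 hx₀ hxa hc ht)
    rw [Complex.ofReal_re, Complex.re_ofReal_mul] at hB
    have hconj : ∀ y : ℝ, (h |y|).re = (h y).re := by
      intro y
      rcases abs_choice y with hy | hy
      · rw [hy]
      · rw [hy]
        have : h (-y) = (starRingEnd ℂ) (h y) := by
          have hcc : (c + (-y : ℝ) * Complex.I : ℂ) = (starRingEnd ℂ) (c + y * Complex.I) := by
            simp
          have harg : Complex.arg (c + y * Complex.I) ≠ π := by
            intro h
            have := (Complex.arg_eq_pi_iff.1 h).1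
            simp at this
            linarith
          simp only [hh, laplaceExp]
          rw [hcc, Complex.log_conj _ harg]
          simp only [map_mul, map_div₀, map_one, map_add, ← Complex.exp_conj, Complex.conj_ofReal]
        rw [this, Complex.conj_re]
    have hre : (∫ y, h y).re = 2 * ∫ y in Set.Ioi (0 : ℝ), (h y).re := by
      rw [← integral_comp_abs (f := fun y => (h y).re)]
      simp_rw [hconj]
      exact (Complex.reCLM.integral_comp_comm hhi).symm
    rw [hre] at hB
    rw [hB, setIntegral_congr_fun measurableSet_Ioi fun y hy => congrArg Complex.re (heq y hy)]
    have hS : ∀ S : ℝ, (2 * π)⁻¹ * (2 * S) = π⁻¹ * S := fun S => by field_simp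
    exact hS _

lemma integral_sub_sub_add {X : Type*} [MeasurableSpace X] {μ : Measure X}
    {f₁ f₂ f₃ f₄ : X → ℝ} (h₁ : Integrable f₁ μ) (h₂ : Integrable f₂ μ) (h₃ : Integrable f₃ μ)
    (h₄ : Integrable f₄ μ) : ∫ x, f₁ x - f₂ x - f₃ x + f₄ x ∂μ
      = (∫ x, f₁ x ∂μ) - (∫ x, f₂ x ∂μ) - (∫ x, f₃ x ∂μ) + ∫ x, f₄ x ∂μ := by
  have h₁₂ : Integrable (fun x => f₁ x - f₂ x) μ := h₁.sub h₂
  have h₁₂₃ : Integrable (fun x => f₁ x - f₂ x - f₃ x) μ := h₁₂.sub h₃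
  rw [integral_add h₁₂₃ h₄, integral_sub h₁₂ h₃, integral_sub h₁ h₂]

lemma Ufun_second_difference (ha2 : 0 < a2) (ha12 : a2 < a1) (ha1 : a1 < 1) (hC1 : 0 < C1)
    (hC2 : 0 < C2) {δ τ t : ℝ} (hδ : 0 < δ) (hτ : 0 ≤ τ) (ht : τ < t) :
    Ufun a1 a2 C1 C2 (t + δ - τ) - Ufun a1 a2 C1 C2 (t - τ) - Ufun a1 a2 C1 C2 (t + δ)
      + Ufun a1 a2 C1 C2 t
      = π⁻¹ * ∫ r in Set.Ioi (0 : ℝ), exp (-(t * r)) * (1 - exp (-(δ * r))) *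
        (exp (τ * r) - 1) / r * cutDensity a1 a2 C1 C2 r := by
  obtain ⟨x₀, hxa, hx₀⟩ : ∃ x : ℝ, C2 / C1 < x ^ (a1 - a2) ∧ 0 < x :=
    (((tendsto_rpow_atTop (by linarith)).eventually_gt_atTop (C2 / C1)).and
      (eventually_gt_atTop 0)).exists
  have hc : x₀ < x₀ + 1 := by linarith
  set c := x₀ + 1 with hcdef
  have hc0 : 0 < c := hx₀.trans hc
  have U : ∀ {x : ℝ}, 0 < x → _ := fun {x} hx =>
    Ufun_bromwich_half ha2 ha12 ha1 hC1 hC2 hx₀ hxa hc hx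
  obtain ⟨i1, u1⟩ := U (x := t + δ - τ) (by linarith)
  obtain ⟨i2, u2⟩ := U (x := t - τ) (by linarith)
  obtain ⟨i3, u3⟩ := U (x := t + δ) (by linarith)
  obtain ⟨i4, u4⟩ := U (x := t) (by linarith)
  have j1 := i1.re
  have j2 := i2.re
  have j3 := i3.re
  have j4 := i4.re
  simp only [RCLike.re_to_complex] at j1 j2 j3 j4
  have e : ∀ y : ℝ, diffKernel a1 a2 C1 C2 δ τ t (c + y * Complex.I)
      = Complex.exp ((t + δ - τ : ℝ) * (c + y * Complex.I)) * (1 / ((c + y * Complex.I) *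
          laplaceExp a1 a2 C1 C2 (upperLog (c + y * Complex.I))))
        - Complex.exp ((t - τ : ℝ) * (c + y * Complex.I)) * (1 / ((c + y * Complex.I) *
          laplaceExp a1 a2 C1 C2 (upperLog (c + y * Complex.I))))
        - Complex.exp ((t + δ : ℝ) * (c + y * Complex.I)) * (1 / ((c + y * Complex.I) *
          laplaceExp a1 a2 C1 C2 (upperLog (c + y * Complex.I))))
        + Complex.exp ((t : ℝ) * (c + y * Complex.I)) * (1 / ((c + y * Complex.I) *
          laplaceExp a1 a2 C1 C2 (upperLog (c + y * Complex.I)))) := by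
    intro y
    rw [diffKernel]
    generalize (c + y * Complex.I : ℂ) = z
    generalize 1 / (z * laplaceExp a1 a2 C1 C2 (upperLog z)) = q
    push_cast
    rw [show (t + δ - τ : ℂ) * z = t * z + δ * z + -τ * z by ring,
      show (t - τ : ℂ) * z = t * z + -τ * z by ring,
      show (t + δ : ℂ) * z = t * z + δ * z by ring]
    simp only [Complex.exp_add]
    ring
  have hsum : Ufun a1 a2 C1 C2 (t + δ - τ) - Ufun a1 a2 C1 C2 (t - τ) - Ufun a1 a2 C1 C2 (t + δ)
      + Ufun a1 a2 C1 C2 t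
      = π⁻¹ * ∫ y in Set.Ioi (0 : ℝ),
        (diffKernel a1 a2 C1 C2 δ τ t (c + y * Complex.I)).re := by
    rw [u1, u2, u3, u4]
    simp_rw [e, Complex.add_re, Complex.sub_re]
    rw [integral_sub_sub_add j1 j2 j3 j4]
    ring
  have hDi : IntegrableOn (fun y : ℝ => (diffKernel a1 a2 C1 C2 δ τ t (c + y * Complex.I)).re)
      (Set.Ioi 0) := by
    simp_rw [e, Complex.add_re, Complex.sub_re]
    exact ((j1.sub j2).sub j3).add j4
  have hcut := integrableOn_cut_integrand ha2 ha12 ha1 hC1 hC2 hδ hτ ht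
  have himeq : ∀ r ∈ Set.Ioi (0 : ℝ), _ := fun r hr =>
    (diffKernel_neg_ofReal_im (a1 := a1) (a2 := a2) (C1 := C1) (C2 := C2) (δ := δ) (τ := τ)
      (t := t) (r := r) hr).symm
  have hIm : IntegrableOn (fun r : ℝ => (diffKernel a1 a2 C1 C2 δ τ t (-(r : ℂ))).im)
      (Set.Ioi 0) := hcut.neg.congr_fun himeq measurableSet_Ioi
  have hlim := (intervalIntegral_tendsto_integral_Ioi 0 hDi tendsto_id).add
    (intervalIntegral_tendsto_integral_Ioi 0 hIm tendsto_id)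
  have h0 := tendsto_nhds_unique hlim
    (tendsto_re_vertical_add_cut ha2 ha12 ha1 hC1 hC2 hδ hτ ht hc0)
  rw [← setIntegral_congr_fun measurableSet_Ioi himeq, integral_neg] at h0
  rw [hsum, add_neg_eq_zero.1 h0]


lemma tendsto_mul_exp_div_sub_one (x : ℝ) :
    Tendsto (fun t : ℝ => t * (exp (x / t) - 1)) atTop (𝓝 x) := by
  have hd : HasDerivAt (fun h : ℝ => exp (x * h)) x 0 := by
    simpa using ((hasDerivAt_id (0 : ℝ)).const_mul x).exp
  have h := hd.tendsto_slope_zero_right.comp tendsto_inv_atTop_nhdsGT_zero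
  refine h.congr fun t => ?_
  simp [div_eq_mul_inv]

lemma tendsto_rpow_mul_cutDensity (ha12 : a2 < a1) (hC2 : 0 < C2) :
    Tendsto (fun r => r ^ a2 * cutDensity a1 a2 C1 C2 r) (𝓝[>] 0) (𝓝 (sin (π * a2) / C2)) := by
  have hpow : Tendsto (fun r : ℝ => ((r ^ (a1 - a2) : ℝ) : ℂ)) (𝓝[>] 0) (𝓝 0) := by
    have h : ContinuousAt (fun r : ℝ => r ^ (a1 - a2)) 0 :=
      continuousAt_rpow_const _ _ (Or.inr (by linarith))
    have h' := (Complex.continuous_ofReal.tendsto _).comp h.tendsto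
    simp only [zero_rpow (sub_pos.2 ha12).ne', Complex.ofReal_zero] at h'
    exact h'.mono_left nhdsWithin_le_nhds
  have hden : Tendsto (fun r : ℝ =>
      C1 * ((r ^ (a1 - a2) : ℝ) : ℂ) * Complex.exp (a1 * (π * Complex.I))
      + C2 * Complex.exp (a2 * (π * Complex.I))) (𝓝[>] 0)
      (𝓝 (C2 * Complex.exp (a2 * (π * Complex.I)))) := by
    simpa using ((hpow.const_mul (C1 : ℂ)).mul_const (Complex.exp (a1 * (π * Complex.I)))).add_const
      (C2 * Complex.exp (a2 * (π * Complex.I)))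
  have hne : (C2 * Complex.exp (a2 * (π * Complex.I)) : ℂ) ≠ 0 :=
    mul_ne_zero (by exact_mod_cast hC2.ne') (Complex.exp_ne_zero _)
  have hlim := (Complex.continuous_im.tendsto _).comp (hden.inv₀ hne)
  have hval : (C2 * Complex.exp (a2 * (π * Complex.I)) : ℂ)⁻¹.im = -(sin (π * a2) / C2) := by
    rw [mul_inv, ← Complex.exp_neg, ← Complex.ofReal_inv, Complex.im_ofReal_mul,
      show -((a2 : ℂ) * (π * Complex.I)) = ((-(π * a2) : ℝ) : ℂ) * Complex.I by push_cast; ring,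
      Complex.exp_ofReal_mul_I_im, sin_neg]
    ring
  rw [hval] at hlim
  have h := hlim.neg
  rw [neg_neg] at h
  refine h.congr' ?_
  filter_upwards [self_mem_nhdsWithin] with r hr
  have hr' : 0 < r := hr
  have hexp : ∀ a : ℝ, Complex.exp (a * (log r + π * Complex.I))
      = ((r ^ a : ℝ) : ℂ) * Complex.exp (a * (π * Complex.I)) := by
    intro a
    rw [mul_add, Complex.exp_add, rpow_def_of_pos hr', mul_comm (log r)]
    push_cast
    rfl
  have he : laplaceExp a1 a2 C1 C2 (log r + π * Complex.I) = ((r ^ a2 : ℝ) : ℂ) *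
      (C1 * ((r ^ (a1 - a2) : ℝ) : ℂ) * Complex.exp (a1 * (π * Complex.I))
        + C2 * Complex.exp (a2 * (π * Complex.I))) := by
    rw [laplaceExp, hexp, hexp, show r ^ a1 = r ^ a2 * r ^ (a1 - a2) by
      rw [← rpow_add hr']; ring_nf]
    push_cast
    ring
  have hp : r ^ a2 ≠ 0 := (rpow_pos_of_pos hr' _).ne'
  rw [cutDensity, he, one_div, mul_inv, ← Complex.ofReal_inv, Complex.im_ofReal_mul]
  simp only [Function.comp_apply]
  field_simp

lemma abs_second_difference_le (ha2 : 0 < a2) (ha12 : a2 < a1) (ha1 : a1 < 1) (hC1 : 0 < C1)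
    (hC2 : 0 < C2) {δ τ t : ℝ} (hδ : 0 < δ) (hτ : 0 ≤ τ) (ht0 : 0 < t) (ht : 2 * τ ≤ t) :
    |t ^ (2 - a2) * (Ufun a1 a2 C1 C2 (t + δ - τ) - Ufun a1 a2 C1 C2 (t - τ)
      - Ufun a1 a2 C1 C2 (t + δ) + Ufun a1 a2 C1 C2 t)|
      ≤ π⁻¹ * (δ / (cos ((a1 - a2) * π / 2) * C2) * (2 ^ (2 - a2) * Gamma (2 - a2))) * τ := by
  have hc := cos_half_pos ha2 ha12 ha1
  have hp : 0 < 2 - a2 := by linarith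
  have hx : 0 < t - τ := by linarith
  have hG := Gamma_pos_of_pos hp
  rw [Ufun_second_difference ha2 ha12 ha1 hC1 hC2 hδ hτ (by linarith)]
  have h : ‖∫ r in Set.Ioi (0 : ℝ), exp (-(t * r)) * (1 - exp (-(δ * r))) *
        (exp (τ * r) - 1) / r * cutDensity a1 a2 C1 C2 r‖
      ≤ ∫ r in Set.Ioi (0 : ℝ), δ * τ / (cos ((a1 - a2) * π / 2) * C2) *
        (r ^ (2 - a2 - 1) * exp (-((t - τ) * r))) := by
    refine norm_integral_le_of_norm_le ((integrableOn_rpow_mul_exp_neg_mul hp hx).const_mul _) ?_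
    filter_upwards [ae_restrict_mem measurableSet_Ioi] with r hr
    exact abs_cut_integrand_le ha2 ha12 ha1 hC1 hC2 hδ hτ hr
  rw [integral_const_mul, integral_rpow_mul_exp_neg_mul_Ioi hp hx, norm_eq_abs] at h
  have h2 : t ^ (2 - a2) * (1 / (t - τ)) ^ (2 - a2) ≤ 2 ^ (2 - a2) := by
    rw [← mul_rpow ht0.le (by positivity)]
    refine rpow_le_rpow (by positivity) ?_ hp.le
    rw [mul_one_div, div_le_iff₀ hx]
    linarith
  rw [abs_mul, abs_mul, abs_of_pos (rpow_pos_of_pos ht0 _), abs_of_pos (inv_pos.2 pi_pos)]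
  calc _ ≤ t ^ (2 - a2) * (π⁻¹ * (δ * τ / (cos ((a1 - a2) * π / 2) * C2) *
        ((1 / (t - τ)) ^ (2 - a2) * Gamma (2 - a2)))) := by gcongr
    _ = π⁻¹ * (δ * τ / (cos ((a1 - a2) * π / 2) * C2) *
        ((t ^ (2 - a2) * (1 / (t - τ)) ^ (2 - a2)) * Gamma (2 - a2))) := by ring
    _ ≤ π⁻¹ * (δ * τ / (cos ((a1 - a2) * π / 2) * C2) * (2 ^ (2 - a2) * Gamma (2 - a2))) := by
      gcongr
    _ = _ := by ring

lemma tendsto_second_difference (ha2 : 0 < a2) (ha12 : a2 < a1) (ha1 : a1 < 1) (hC1 : 0 < C1)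
    (hC2 : 0 < C2) {δ τ : ℝ} (hδ : 0 < δ) (hτ : 0 ≤ τ) :
    Tendsto (fun t : ℝ => t ^ (2 - a2) * (Ufun a1 a2 C1 C2 (t + δ - τ) - Ufun a1 a2 C1 C2 (t - τ)
      - Ufun a1 a2 C1 C2 (t + δ) + Ufun a1 a2 C1 C2 t)) atTop
      (𝓝 (δ * τ * (1 - a2) / (C2 * Gamma a2))) := by
  have hc := cos_half_pos ha2 ha12 ha1
  have hp : 0 < 2 - a2 := by linarith
  set F : ℝ → ℝ → ℝ := fun t r => exp (-(t * r)) * (1 - exp (-(δ * r))) * (exp (τ * r) - 1) / r *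
    cutDensity a1 a2 C1 C2 r with hF
  set B := δ * τ / (cos ((a1 - a2) * π / 2) * C2) with hB
  have hB0 : 0 ≤ B := by positivity
  have hscale : ∀ t : ℝ, 0 < t → ∫ r in Set.Ioi (0 : ℝ), F t r
      = t⁻¹ * ∫ y in Set.Ioi (0 : ℝ), F t (t⁻¹ * y) := by
    intro t ht
    rw [integral_comp_mul_left_Ioi (F t) 0 (inv_pos.2 ht)]
    simp [ht.ne']
  have hmain : Tendsto (fun t : ℝ => ∫ y in Set.Ioi (0 : ℝ), t ^ (1 - a2) * F t (t⁻¹ * y)) atTop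
      (𝓝 (∫ y in Set.Ioi (0 : ℝ), δ * τ * (sin (π * a2) / C2) *
        (y ^ (2 - a2 - 1) * exp (-(1 * y))))) := by
    refine tendsto_integral_filter_of_dominated_convergence
      (fun y => B * (y ^ (2 - a2 - 1) * exp (-(1 / 2 * y)))) ?_ ?_ ?_ ?_
    · refine Eventually.of_forall fun t => ?_
      have := measurable_cutDensity (a1 := a1) (a2 := a2) (C1 := C1) (C2 := C2)
      exact Measurable.aestronglyMeasurable (by fun_prop)
    · filter_upwards [eventually_gt_atTop 0, eventually_ge_atTop (2 * τ)] with t ht0 ht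
      filter_upwards [ae_restrict_mem measurableSet_Ioi] with y hy
      have hy' : 0 < y := hy
      rw [norm_mul, norm_of_nonneg (by positivity)]
      have h := abs_cut_integrand_le ha2 ha12 ha1 hC1 hC2 (t := t) hδ hτ
        (mul_pos (inv_pos.2 ht0) hy')
      calc _ ≤ t ^ (1 - a2) * (B * ((t⁻¹ * y) ^ (2 - a2 - 1) *
            exp (-((t - τ) * (t⁻¹ * y))))) := by
            gcongr
            exact h
        _ = B * (y ^ (2 - a2 - 1) * exp (-((t - τ) * (t⁻¹ * y)))) := by
            rw [mul_rpow (inv_nonneg.2 ht0.le) hy'.le, inv_rpow ht0.le,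
              show 2 - a2 - 1 = 1 - a2 by ring]
            have := (rpow_pos_of_pos ht0 (1 - a2)).ne'
            field_simp
        _ ≤ _ := by
            gcongr ?_ * (?_ * exp ?_)
            have : 1 / 2 ≤ (t - τ) * t⁻¹ := by
              rw [← div_eq_mul_inv, le_div_iff₀ ht0]
              linarith
            rw [← mul_assoc]
            gcongr
    · exact (integrableOn_rpow_mul_exp_neg_mul hp (by norm_num)).const_mul _
    · filter_upwards [ae_restrict_mem measurableSet_Ioi] with y hy
      have hy' : 0 < y := hy
      have l1 := (tendsto_mul_exp_div_sub_one (-(δ * y))).neg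
      have l2 := tendsto_mul_exp_div_sub_one (τ * y)
      have l3 : Tendsto (fun t : ℝ => t⁻¹ * y) atTop (𝓝[>] 0) := by
        refine tendsto_nhdsWithin_iff.2 ⟨by simpa using tendsto_inv_atTop_zero.mul_const y, ?_⟩
        filter_upwards [eventually_gt_atTop 0] with t ht
        exact mul_pos (inv_pos.2 ht) hy'
      have l4 := (tendsto_rpow_mul_cutDensity (C1 := C1) ha12 hC2).comp l3
      have l := ((l1.mul l2).mul l4).const_mul (exp (-y) * y ^ (-a2 - 1))
      have hval : exp (-y) * y ^ (-a2 - 1) * (- -(δ * y) * (τ * y) * (sin (π * a2) / C2))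
          = δ * τ * (sin (π * a2) / C2) * (y ^ (2 - a2 - 1) * exp (-(1 * y))) := by
        rw [show 2 - a2 - 1 = 2 + (-a2 - 1) by ring, rpow_add hy', rpow_two, one_mul]
        ring
      rw [hval] at l
      refine l.congr' ?_
      filter_upwards [eventually_gt_atTop 0] with t ht
      have ht' := (rpow_pos_of_pos ht a2).ne'
      have hy'' := (rpow_pos_of_pos hy' a2).ne'
      simp only [hF, Function.comp_apply]
      rw [show t * (t⁻¹ * y) = y by field_simp, show δ * (t⁻¹ * y) = δ * y / t by ring,
        show τ * (t⁻¹ * y) = τ * y / t by ring, neg_div, mul_rpow (inv_nonneg.2 ht.le) hy'.le,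
        inv_rpow ht.le, rpow_sub hy', rpow_neg hy'.le, rpow_sub ht, rpow_one, rpow_one]
      field_simp
      ring
  rw [integral_const_mul, integral_rpow_mul_exp_neg_mul_Ioi hp one_pos] at hmain
  have hfin := hmain.const_mul π⁻¹
  have hsin : sin (π * a2) ≠ 0 :=
    (sin_pos_of_pos_of_lt_pi (by positivity) (by nlinarith [pi_pos])).ne'
  have hG : Gamma a2 ≠ 0 := (Gamma_pos_of_pos ha2).ne'
  have hconst : π⁻¹ * (δ * τ * (sin (π * a2) / C2) * ((1 / 1) ^ (2 - a2) * Gamma (2 - a2)))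
      = δ * τ * (1 - a2) / (C2 * Gamma a2) := by
    have h1 := Real.Gamma_mul_Gamma_one_sub a2
    have h2 := Gamma_add_one (s := 1 - a2) (by linarith)
    rw [show 1 - a2 + 1 = 2 - a2 by ring] at h2
    rw [div_one, one_rpow, one_mul, h2, show Gamma (1 - a2) = π / sin (π * a2) / Gamma a2 by
      rw [← h1]; field_simp]
    field_simp
  rw [hconst] at hfin
  refine hfin.congr' ?_
  filter_upwards [eventually_gt_atTop τ, eventually_gt_atTop 0] with t ht ht0
  rw [Ufun_second_difference ha2 ha12 ha1 hC1 hC2 hδ hτ ht, integral_const_mul, hscale t ht0,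
    show 2 - a2 = 1 - a2 + 1 by ring, rpow_add_one ht0.ne']
  field_simp

lemma tendsto_integral_second_difference (ha2 : 0 < a2) (ha12 : a2 < a1) (ha1 : a1 < 1)
    (hC1 : 0 < C1) (hC2 : 0 < C2) {δ s : ℝ} (hδ : 0 < δ) (hs : 0 ≤ s) :
    Tendsto (fun t : ℝ => ∫ τ in (0 : ℝ)..s, t ^ (2 - a2) * (Ufun a1 a2 C1 C2 (t + δ - τ)
      - Ufun a1 a2 C1 C2 (t - τ) - Ufun a1 a2 C1 C2 (t + δ) + Ufun a1 a2 C1 C2 t) *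
      ufun a1 a2 C1 C2 τ) atTop (𝓝 ((1 - a2) * δ * Kfun a1 a2 C1 C2 s)) := by
  have hG : Gamma a2 ≠ 0 := (Gamma_pos_of_pos ha2).ne'
  have hU := continuous_Ufun (C1 := C1) (C2 := C2) ha2 ha12
  have hu := intervalIntegrable_ufun (C1 := C1) (C2 := C2) ha2 ha12 0 s
  have hK : (1 - a2) * δ * Kfun a1 a2 C1 C2 s
      = ∫ τ in (0 : ℝ)..s, δ * τ * (1 - a2) / (C2 * Gamma a2) * ufun a1 a2 C1 C2 τ := by
    have h : ∀ τ : ℝ, δ * τ * (1 - a2) / (C2 * Gamma a2) * ufun a1 a2 C1 C2 τ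
        = δ * (1 - a2) / (C2 * Gamma a2) * (τ * ufun a1 a2 C1 C2 τ) := fun τ => by ring
    simp_rw [h]
    rw [intervalIntegral.integral_const_mul, integral_mul_ufun ha2 ha12 hC2.ne' hs]
    field_simp
  rw [hK]
  set B := π⁻¹ * (δ / (cos ((a1 - a2) * π / 2) * C2) * (2 ^ (2 - a2) * Gamma (2 - a2))) with hB
  have hmem : ∀ τ ∈ Set.uIoc 0 s, 0 ≤ τ ∧ τ ≤ s := fun τ hτ => by
    rw [Set.uIoc_of_le hs] at hτ
    exact ⟨hτ.1.le, hτ.2⟩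
  refine intervalIntegral.tendsto_integral_filter_of_dominated_convergence
    (fun τ => B * τ * |ufun a1 a2 C1 C2 τ|) ?_ ?_ ?_ ?_
  · refine Eventually.of_forall fun t => ?_
    refine AEStronglyMeasurable.mul (Continuous.aestronglyMeasurable (by fun_prop)) ?_
    exact hu.def'.aestronglyMeasurable
  · filter_upwards [eventually_gt_atTop 0, eventually_ge_atTop (2 * s)] with t ht0 ht
    refine ae_of_all _ fun τ hτ => ?_
    obtain ⟨hτ0, hτs⟩ := hmem τ hτ
    rw [norm_mul, norm_eq_abs, norm_eq_abs]
    gcongr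
    exact abs_second_difference_le ha2 ha12 ha1 hC1 hC2 hδ hτ0 ht0 (by linarith)
  · exact hu.abs.continuousOn_mul (by fun_prop)
  · refine ae_of_all _ fun τ hτ => ?_
    exact (tendsto_second_difference ha2 ha12 ha1 hC1 hC2 hδ (hmem τ hτ).1).mul_const _

lemma CovY_of_le (ha2 : 0 < a2) (ha12 : a2 < a1) {s t : ℝ} (hs : 0 ≤ s) (hst : s ≤ t) :
    CovY a1 a2 C1 C2 s t
      = (∫ τ in (0 : ℝ)..s, Ufun a1 a2 C1 C2 (s - τ) * ufun a1 a2 C1 C2 τ)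
      + ∫ τ in (0 : ℝ)..s, (Ufun a1 a2 C1 C2 (t - τ) - Ufun a1 a2 C1 C2 t) *
        ufun a1 a2 C1 C2 τ := by
  have hU := continuous_Ufun (C1 := C1) (C2 := C2) ha2 ha12
  have hu := intervalIntegrable_ufun (C1 := C1) (C2 := C2) ha2 ha12 0 s
  have hi : ∀ x : ℝ, IntervalIntegrable
      (fun τ => Ufun a1 a2 C1 C2 (x - τ) * ufun a1 a2 C1 C2 τ) volume 0 s := fun x =>
    hu.continuousOn_mul (by fun_prop)
  rw [CovY, min_eq_left hst]
  simp_rw [add_mul, sub_mul]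
  rw [intervalIntegral.integral_add (hi s) (hi t),
    intervalIntegral.integral_sub (hi t) (hu.const_mul _), intervalIntegral.integral_const_mul,
    integral_ufun ha2 ha12 hs]
  ring

lemma CovY_sub_CovY (ha2 : 0 < a2) (ha12 : a2 < a1) {δ s t : ℝ} (hδ : 0 ≤ δ) (hs : 0 ≤ s)
    (hst : s ≤ t) :
    CovY a1 a2 C1 C2 s (t + δ) - CovY a1 a2 C1 C2 s t
      = ∫ τ in (0 : ℝ)..s, (Ufun a1 a2 C1 C2 (t + δ - τ) - Ufun a1 a2 C1 C2 (t - τ)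
        - Ufun a1 a2 C1 C2 (t + δ) + Ufun a1 a2 C1 C2 t) * ufun a1 a2 C1 C2 τ := by
  have hU := continuous_Ufun (C1 := C1) (C2 := C2) ha2 ha12
  have hu := intervalIntegrable_ufun (C1 := C1) (C2 := C2) ha2 ha12 0 s
  have hi : ∀ x : ℝ, IntervalIntegrable (fun τ => (Ufun a1 a2 C1 C2 (x - τ) - Ufun a1 a2 C1 C2 x) *
      ufun a1 a2 C1 C2 τ) volume 0 s := fun x => hu.continuousOn_mul (by fun_prop)
  rw [CovY_of_le ha2 ha12 hs hst, CovY_of_le ha2 ha12 hs (by linarith), add_sub_add_left_eq_sub,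
    ← intervalIntegral.integral_sub (hi _) (hi _)]
  congr 1 with τ
  ring

end Renewal

/-- For fixed `λ > 0`, `δ > 0` and `s ≥ 0`, the covariance of the mixed fractional
Poissonian noise satisfies `t^{2-α₂} Cov_Z(s,t) → (1-α₂)δλ²(K(s+δ) - K(s))` as `t → ∞`. -/
theorem stmt_15 (a1 a2 C1 C2 : ℝ) (ha2 : 0 < a2) (ha12 : a2 < a1) (ha1 : a1 < 1)
    (hC1 : 0 < C1) (hC2 : 0 < C2) (hC : C1 + C2 = 1) (lam : ℝ) (hlam : 0 < lam)
    (δ : ℝ) (hδ : 0 < δ) (s : ℝ) (hs : 0 ≤ s) :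
    Tendsto (fun t : ℝ => t ^ (2 - a2) * CovZ a1 a2 C1 C2 lam δ s t) atTop
      (𝓝 ((1 - a2) * δ * lam ^ 2
        * (Kfun a1 a2 C1 C2 (s + δ) - Kfun a1 a2 C1 C2 s))) := by
  have hlim := ((tendsto_integral_second_difference ha2 ha12 ha1 hC1 hC2 hδ
    (add_nonneg hs hδ.le)).sub
    (tendsto_integral_second_difference ha2 ha12 ha1 hC1 hC2 hδ hs)).const_mul (lam ^ 2)
  rw [show lam ^ 2 * ((1 - a2) * δ * Kfun a1 a2 C1 C2 (s + δ) - (1 - a2) * δ * Kfun a1 a2 C1 C2 s)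
    = (1 - a2) * δ * lam ^ 2 * (Kfun a1 a2 C1 C2 (s + δ) - Kfun a1 a2 C1 C2 s) by ring] at hlim
  refine hlim.congr' ?_
  filter_upwards [eventually_ge_atTop (s + δ)] with t ht
  simp_rw [mul_assoc (t ^ (2 - a2))]
  rw [intervalIntegral.integral_const_mul, intervalIntegral.integral_const_mul,
    ← CovY_sub_CovY ha2 ha12 hδ.le (add_nonneg hs hδ.le) ht,
    ← CovY_sub_CovY ha2 ha12 hδ.le hs (by linarith)]
  unfold CovZ CovN
  rw [min_eq_left (by linarith : s + δ ≤ t + δ), min_eq_left (by linarith : s ≤ t),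
    min_eq_left ht, min_eq_left (by linarith : s ≤ t + δ)]
  ring
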